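/- arXiv:1301.6385 — 4 statements merged into one kernel-verified Lean document; each statement's English description precedes it below -/
import Mathlib

section
/- Let X, Y be real random variables and Z an ℝ^m-valued random variable, all on the same probability space. The sequence of random vectors ({nX+Y}, X, Y, Z) converges in distribution, as n → ∞, to (U, X, Y, Z) where U is uniform on [0,1] and independent of (X,Y,Z), if and only if the law of X is Rajchman (its characteristic function tends to 0 at infinity). -/
open MeasureTheory Filter

theorem isClosed_setOf_tendsto_of_dist_le {ι E F : Type*} [PseudoMetricSpace E]
    [PseudoMetricSpace F] {l : Filter ι} {f : ι → E → F} {g : E → F}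
    (hf : ∀ i x y, dist (f i x) (f i y) ≤ dist x y) (hg : ∀ x y, dist (g x) (g y) ≤ dist x y) :
    IsClosed {x | Tendsto (fun i => f i x) l (nhds (g x))} :=
  Equicontinuous.isClosed_setOfPred_tendsto
    (LipschitzWith.uniformEquicontinuous f 1 fun i =>
      LipschitzWith.mk_one (hf i)).equicontinuous (LipschitzWith.mk_one hg).continuous

theorem tendsto_inner_zero_of_forall_range {𝕜 H ι : Type*} [RCLike 𝕜] [NormedAddCommGroup H]
    [InnerProductSpace 𝕜 H] [CompleteSpace H] {l : Filter ι} {e : ι → H}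
    (hb : ∀ i, ‖e i‖ ≤ 1) (h : ∀ j, Tendsto (fun i => inner 𝕜 (e i) (e j)) l (nhds 0)) (x : H) :
    Tendsto (fun i => inner 𝕜 (e i) x) l (nhds 0) := by
  let S : Submodule 𝕜 H :=
    { carrier := {x | Tendsto (fun i => inner 𝕜 (e i) x) l (nhds 0)}
      add_mem' := fun {a b} ha hb => by
        simpa [inner_add_right] using Tendsto.add ha hb
      zero_mem' := by simpa using tendsto_const_nhds
      smul_mem' := fun c a ha => by
        simpa [inner_smul_right] using Tendsto.const_mul c ha }
  have hS : IsClosed (S : Set H) := by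
    refine isClosed_setOf_tendsto_of_dist_le (f := fun i x => inner 𝕜 (e i) x)
      (g := fun _ => (0 : 𝕜)) (fun i x y => ?_) (by simp)
    rw [dist_eq_norm, dist_eq_norm, ← inner_sub_right]
    exact (norm_inner_le_norm _ _).trans (mul_le_of_le_one_left (norm_nonneg _) (hb i))
  let K := (Submodule.span 𝕜 (Set.range e)).topologicalClosure
  have hK : K ≤ S := Submodule.topologicalClosure_minimal _
    (Submodule.span_le.2 (Set.range_subset_iff.2 h)) hS
  have hK' : Kᗮ ≤ S := fun y hy => by
    have : ∀ i, inner 𝕜 (e i) y = 0 := fun i =>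
      (Submodule.mem_orthogonal K y).1 hy _
        (Submodule.le_topologicalClosure _ (Submodule.subset_span ⟨i, rfl⟩))
    change Tendsto _ _ _
    simpa [this] using tendsto_const_nhds
  have : CompleteSpace K :=
    (Submodule.isClosed_topologicalClosure _).completeSpace_coe
  have : x ∈ K ⊔ Kᗮ := by
    rw [Submodule.sup_orthogonal_of_hasOrthogonalProjection]; trivial
  exact sup_le hK hK' this

theorem tendsto_integral_exp_mul {Ω : Type*} [MeasurableSpace Ω] {P : Measure Ω}
    [IsProbabilityMeasure P] {X : Ω → ℝ} (hX : Measurable X)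
    (h : Tendsto (fun u : ℝ => ∫ ω, Complex.exp (Complex.I * (u * X ω)) ∂P)
      (cocompact ℝ) (nhds 0)) {g : Ω → ℂ} (hg : MemLp g 2 P) :
    Tendsto (fun u : ℝ => ∫ ω, Complex.exp (Complex.I * (u * X ω)) * g ω ∂P)
      (cocompact ℝ) (nhds 0) := by
  have hm : ∀ u : ℝ, MemLp (fun ω => Complex.exp (-(Complex.I * (u * X ω)))) 2 P := fun u => by
    refine MemLp.of_bound (by fun_prop) 1 (ae_of_all _ fun ω => ?_)
    simp [Complex.norm_exp]
  have hconj : ∀ u x : ℝ, (starRingEnd ℂ) (Complex.exp (-(Complex.I * (u * x)))) =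
      Complex.exp (Complex.I * (u * x)) := fun u x => by
    rw [← Complex.exp_conj]; simp
  have hin : ∀ (u : ℝ) (f : Ω → ℂ) (hf : MemLp f 2 P),
      inner ℂ ((hm u).toLp _) (hf.toLp f) =
        ∫ ω, Complex.exp (Complex.I * (u * X ω)) * f ω ∂P := fun u f hf => by
    rw [L2.inner_def]
    refine integral_congr_ae ?_
    filter_upwards [(hm u).coeFn_toLp, hf.coeFn_toLp] with ω h1 h2
    rw [h1, h2, RCLike.inner_apply, hconj, mul_comm]
  have key := tendsto_inner_zero_of_forall_range (𝕜 := ℂ) (l := cocompact ℝ)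
    (e := fun u => (hm u).toLp _) (fun u => ?_) (fun v => ?_) (hg.toLp g)
  · simpa only [hin] using key
  · rw [Lp.norm_toLp]
    refine ENNReal.toReal_le_of_le_ofReal zero_le_one ?_
    refine (eLpNorm_le_of_ae_bound (C := 1) (ae_of_all _ fun ω => ?_)).trans (by simp)
    simp [Complex.norm_exp]
  · simp only [hin]
    have : Tendsto (fun u : ℝ => u - v) (cocompact ℝ) (cocompact ℝ) :=
      (Homeomorph.subRight v).isClosedEmbedding.tendsto_cocompact
    refine (h.comp this).congr fun u => integral_congr_ae (ae_of_all _ fun ω => ?_)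
    simp only [← Complex.exp_add]
    congr 1
    push_cast
    ring

theorem tendsto_integral_eval {Ω K : Type*} [MeasurableSpace Ω] {P : Measure Ω}
    [IsProbabilityMeasure P] [TopologicalSpace K] [CompactSpace K]
    [TopologicalSpace.MetrizableSpace K]
    [MeasurableSpace K] [BorelSpace K] {μ : Measure K} [IsProbabilityMeasure μ]
    {v : ℕ → Ω → K} (hv : ∀ n, Measurable (v n))
    (h : ∀ (q : C(K, ℝ)) (A : Set Ω), MeasurableSet A →
      Tendsto (fun n => ∫ ω in A, q (v n ω) ∂P) atTop (nhds (P.real A * ∫ u, q u ∂μ)))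
    {f : Ω → C(K, ℝ)} (hf : Integrable f P) :
    Tendsto (fun n => ∫ ω, f ω (v n ω) ∂P) atTop (nhds (∫ ω, ∫ u, f ω u ∂μ ∂P)) := by
  have : SecondCountableTopology K := by
    let := TopologicalSpace.metrizableSpaceMetric K
    infer_instance
  have hev : ∀ n {f : Ω → C(K, ℝ)}, Integrable f P → Integrable (fun ω => f ω (v n ω)) P := by
    intro n f hf
    refine hf.mono ?_ (ae_of_all _ fun ω => (f ω).norm_coe_le_norm _)
    exact (continuous_eval (F := C(K, ℝ))).comp_aestronglyMeasurable
      (hf.1.prodMk (hv n).aestronglyMeasurable)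
  have hq : ∀ q : C(K, ℝ), Integrable q μ := fun q =>
    q.continuous.integrable_of_hasCompactSupport (HasCompactSupport.of_compactSpace _)
  let L : C(K, ℝ) →L[ℝ] ℝ := LinearMap.mkContinuous
    { toFun := fun q => ∫ u, q u ∂μ
      map_add' := fun a b => integral_add (hq a) (hq b)
      map_smul' := fun c a => integral_const_mul _ _ } 1 fun q => by
        refine (norm_integral_le_of_norm_le_const (C := ‖q‖)
          (ae_of_all _ fun u => q.norm_coe_le_norm u)).trans (by simp)
  have hL : ∀ q, ‖L q‖ ≤ ‖q‖ := fun q =>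
    (L.le_opNorm q).trans (mul_le_of_le_one_left (norm_nonneg _)
      (LinearMap.mkContinuous_norm_le _ zero_le_one _))
  have hint : ∀ {f : Ω → C(K, ℝ)}, Integrable f P → Integrable (fun ω => ∫ u, f ω u ∂μ) P :=
    fun hf => L.integrable_comp hf
  refine Integrable.induction (fun f : Ω → C(K, ℝ) => Tendsto (fun n => ∫ ω, f ω (v n ω) ∂P) atTop
    (nhds (∫ ω, ∫ u, f ω u ∂μ ∂P))) ?_ ?_ ?_ ?_ hf
  · intro q A hA _
    have h1 : ∀ n, ∫ ω, (A.indicator (fun _ => q) ω) (v n ω) ∂P = ∫ ω in A, q (v n ω) ∂P := by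
      intro n
      rw [← integral_indicator hA]
      congr 1 with ω
      by_cases hω : ω ∈ A <;> simp [hω]
    have h2 : ∫ ω, ∫ u, (A.indicator (fun _ => q) ω) u ∂μ ∂P = P.real A * ∫ u, q u ∂μ := by
      rw [← smul_eq_mul, ← integral_indicator_const _ hA]
      congr 1 with ω
      by_cases hω : ω ∈ A <;> simp [hω]
    simp only [h1, h2]
    exact h q A hA
  · intro f g _ hf hg h1 h2
    simp only [Pi.add_apply, ContinuousMap.add_apply]
    have e1 : ∫ ω, ∫ u, (f ω u + g ω u) ∂μ ∂P
        = ∫ ω, ∫ u, f ω u ∂μ ∂P + ∫ ω, ∫ u, g ω u ∂μ ∂P := by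
      rw [← integral_add (hint hf) (hint hg)]
      congr 1 with ω
      exact integral_add (hq _) (hq _)
    rw [e1]
    refine (h1.add h2).congr fun n => (integral_add (hev n hf) (hev n hg)).symm
  · refine isClosed_setOf_tendsto_of_dist_le
      (f := fun n (f : Ω →₁[P] C(K, ℝ)) => ∫ ω, f ω (v n ω) ∂P)
      (g := fun f : Ω →₁[P] C(K, ℝ) => ∫ ω, ∫ u, f ω u ∂μ ∂P) ?_ ?_
    · intro n f g
      rw [dist_eq_norm, L1.dist_eq_integral_dist,
        ← integral_sub (hev n (L1.integrable_coeFn f)) (hev n (L1.integrable_coeFn g))]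
      refine norm_integral_le_of_norm_le
        ((L1.integrable_coeFn f).sub (L1.integrable_coeFn g)).norm (ae_of_all _ fun ω => ?_) |>.trans
          (le_of_eq ?_)
      · exact (f ω - g ω).norm_coe_le_norm _
      · simp [dist_eq_norm]
    · intro f g
      rw [dist_eq_norm, L1.dist_eq_integral_dist,
        ← integral_sub (hint (L1.integrable_coeFn f)) (hint (L1.integrable_coeFn g))]
      refine norm_integral_le_of_norm_le
        ((L1.integrable_coeFn f).sub (L1.integrable_coeFn g)).norm (ae_of_all _ fun ω => ?_) |>.trans
          (le_of_eq ?_)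
      · have := hL (f ω - g ω)
        rwa [map_sub] at this
      · simp [dist_eq_norm]
  · intro f g hfg _ h1
    have e1 : ∫ ω, ∫ u, f ω u ∂μ ∂P = ∫ ω, ∫ u, g ω u ∂μ ∂P :=
      integral_congr_ae (hfg.mono fun ω hω => by simp only [hω])
    rw [← e1]
    exact h1.congr fun n => integral_congr_ae (hfg.mono fun ω hω => by simp only [hω])

theorem tendsto_setIntegral_fourier {Ω : Type*} [MeasurableSpace Ω] {P : Measure Ω}
    [IsProbabilityMeasure P] {X Y : Ω → ℝ} (hX : Measurable X) (hY : Measurable Y)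
    (h : Tendsto (fun u : ℝ => ∫ ω, Complex.exp (Complex.I * (u * X ω)) ∂P)
      (cocompact ℝ) (nhds 0)) {A : Set Ω} (hA : MeasurableSet A) {k : ℤ} (hk : k ≠ 0) :
    Tendsto (fun n : ℕ => ∫ ω in A, fourier k (((n : ℝ) * X ω + Y ω : ℝ) : UnitAddCircle) ∂P)
      atTop (nhds 0) := by
  have hg : MemLp (A.indicator fun ω => Complex.exp (2 * Real.pi * Complex.I * k * Y ω)) 2 P := by
    refine MemLp.of_bound (Measurable.indicator (by fun_prop) hA).aestronglyMeasurable 1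
      (ae_of_all _ fun ω => (norm_indicator_le_norm_self _ _).trans ?_)
    simp [Complex.norm_exp]
  have hfreq : Tendsto (fun n : ℕ => 2 * Real.pi * k * (n : ℝ)) atTop (cocompact ℝ) := by
    have hc : 2 * Real.pi * k ≠ 0 := by
      have := Real.pi_ne_zero
      have : (k : ℝ) ≠ 0 := Int.cast_ne_zero.2 hk
      positivity
    have hn : Tendsto (fun n : ℕ => (n : ℝ)) atTop (cocompact ℝ) :=
      tendsto_natCast_atTop_atTop.mono_right atTop_le_cocompact
    exact (Homeomorph.mulLeft₀ _ hc).isClosedEmbedding.tendsto_cocompact.comp hn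
  refine ((tendsto_integral_exp_mul hX h hg).comp hfreq).congr fun n => ?_
  rw [← integral_indicator hA]
  refine integral_congr_ae (ae_of_all _ fun ω => ?_)
  by_cases hω : ω ∈ A
  · simp only [hω, Set.indicator_of_mem, fourier_coe_apply, ← Complex.exp_add]
    congr 1
    push_cast
    ring
  · simp [hω]

theorem tendsto_setIntegral_circle {Ω : Type*} [MeasurableSpace Ω] {P : Measure Ω}
    [IsProbabilityMeasure P] {X Y : Ω → ℝ} (hX : Measurable X) (hY : Measurable Y)
    (h : Tendsto (fun u : ℝ => ∫ ω, Complex.exp (Complex.I * (u * X ω)) ∂P)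
      (cocompact ℝ) (nhds 0)) {A : Set Ω} (hA : MeasurableSet A) (p : C(UnitAddCircle, ℂ)) :
    Tendsto (fun n : ℕ => ∫ ω in A, p (((n : ℝ) * X ω + Y ω : ℝ) : UnitAddCircle) ∂P)
      atTop (nhds (P.real A * ∫ u, p u)) := by
  have hp : ∀ p : C(UnitAddCircle, ℂ), Integrable p := fun p =>
    p.continuous.integrable_of_hasCompactSupport (HasCompactSupport.of_compactSpace _)
  have hi : ∀ (p : C(UnitAddCircle, ℂ)) (n : ℕ), Integrable
      (fun ω => p (((n : ℝ) * X ω + Y ω : ℝ) : UnitAddCircle)) (P.restrict A) := fun p n => by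
    refine Integrable.of_bound (C := ‖p‖) (Continuous.comp_aestronglyMeasurable
      (g := fun x : ℝ => p (x : UnitAddCircle)) ?_ ?_) (ae_of_all _ fun ω => p.norm_coe_le_norm _)
    · exact p.continuous.comp (AddCircle.continuous_mk' 1)
    · fun_prop
  have hPA : P.real A ≤ 1 := measureReal_le_one
  have hvol : (volume : Measure UnitAddCircle).real Set.univ = 1 := by
    simp [Measure.real]
  let S : Submodule ℂ C(UnitAddCircle, ℂ) :=
    { carrier := {p | Tendsto
        (fun n : ℕ => ∫ ω in A, p (((n : ℝ) * X ω + Y ω : ℝ) : UnitAddCircle) ∂P)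
        atTop (nhds (P.real A * ∫ u, p u))}
      add_mem' := fun {a b} ha hb => by
        have := (Tendsto.add ha hb).congr fun n => (integral_add (hi a n) (hi b n)).symm
        rw [← mul_add, ← integral_add (hp a) (hp b)] at this
        exact this
      zero_mem' := by simp
      smul_mem' := fun c a ha => by
        have := (Tendsto.const_mul c ha).congr fun n => (integral_const_mul c _).symm
        rw [mul_left_comm, ← integral_const_mul c] at this
        exact this }
  have hS : IsClosed (S : Set C(UnitAddCircle, ℂ)) := by
    refine isClosed_setOf_tendsto_of_dist_le
      (f := fun (n : ℕ) (p : C(UnitAddCircle, ℂ)) =>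
        ∫ ω in A, p (((n : ℝ) * X ω + Y ω : ℝ) : UnitAddCircle) ∂P)
      (g := fun p : C(UnitAddCircle, ℂ) => P.real A * ∫ u, p u)
      (fun n a b => ?_) (fun a b => ?_)
    · rw [dist_eq_norm, dist_eq_norm, ← integral_sub (hi a n) (hi b n)]
      refine (norm_integral_le_of_norm_le_const (C := ‖a - b‖)
        (ae_of_all _ fun ω => (a - b).norm_coe_le_norm _)).trans ?_
      simpa using mul_le_of_le_one_right (norm_nonneg (a - b)) hPA
    · rw [dist_eq_norm, dist_eq_norm, ← mul_sub, ← integral_sub (hp a) (hp b), norm_mul]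
      have : ‖∫ u, (a u - b u)‖ ≤ ‖a - b‖ :=
        (norm_integral_le_of_norm_le_const (C := ‖a - b‖)
          (ae_of_all _ fun ω => (a - b).norm_coe_le_norm _)).trans (by rw [hvol, mul_one])
      refine (mul_le_of_le_one_left (norm_nonneg _) ?_).trans this
      rwa [Complex.norm_real, Real.norm_of_nonneg measureReal_nonneg]
  have hle : Submodule.span ℂ (Set.range (@fourier 1)) ≤ S := by
    refine Submodule.span_le.2 (Set.range_subset_iff.2 fun k => ?_)
    change Tendsto _ _ _
    by_cases hk : k = 0
    · subst hk
      simp [hvol]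
    · have h0 : ∫ u : UnitAddCircle, fourier k u = 0 :=
        integral_eq_zero_of_add_right_eq_neg (fourier_add_half_inv_index hk one_pos)
      rw [h0, mul_zero]
      exact tendsto_setIntegral_fourier hX hY h hA hk
  have := Submodule.topologicalClosure_minimal _ hle hS
  rw [span_fourier_closure_eq_top] at this
  exact this (Submodule.mem_top (x := p))

theorem tendsto_setIntegral_fract_of_eq {Ω : Type*} [MeasurableSpace Ω] {P : Measure Ω}
    [IsProbabilityMeasure P] {X Y : Ω → ℝ} (hX : Measurable X) (hY : Measurable Y)
    (h : Tendsto (fun u : ℝ => ∫ ω, Complex.exp (Complex.I * (u * X ω)) ∂P)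
      (cocompact ℝ) (nhds 0)) {A : Set Ω} (hA : MeasurableSet A) {f : ℝ → ℝ}
    (hf : Continuous f) (hf01 : f 0 = f 1) :
    Tendsto (fun n : ℕ => ∫ ω in A, f (Int.fract ((n : ℝ) * X ω + Y ω)) ∂P)
      atTop (nhds (P.real A * ∫ u in (0 : ℝ)..1, f u)) := by
  let p : C(UnitAddCircle, ℂ) := ⟨fun x => ((AddCircle.liftIco (1 : ℝ) 0 f x : ℝ) : ℂ),
    Complex.continuous_ofReal.comp (AddCircle.liftIco_zero_continuous hf01 hf.continuousOn)⟩
  have hp : ∀ x : ℝ, p (x : UnitAddCircle) = (f (Int.fract x) : ℂ) := fun x => by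
    have hx : (x : UnitAddCircle) = ((Int.fract x : ℝ) : UnitAddCircle) := by
      rw [Int.fract, AddCircle.coe_sub]
      have : (((⌊x⌋ : ℤ) : ℝ) : UnitAddCircle) = 0 := by
        rw [AddCircle.coe_eq_zero_iff]
        exact ⟨⌊x⌋, by simp⟩
      rw [this, sub_zero]
    rw [hx]
    exact congrArg Complex.ofReal
      (AddCircle.liftIco_zero_coe_apply ⟨Int.fract_nonneg x, Int.fract_lt_one x⟩)
  have hint : ∫ u, p u = ((∫ u in (0 : ℝ)..1, f u : ℝ) : ℂ) := by
    rw [← UnitAddCircle.intervalIntegral_preimage 0, zero_add, ← intervalIntegral.integral_ofReal]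
    refine intervalIntegral.integral_congr fun u hu => ?_
    rw [Set.uIcc_of_le zero_le_one] at hu
    simp only [hp]
    rcases hu.2.eq_or_lt with rfl | h1
    · simp [hf01]
    · rw [Int.fract_eq_self.2 ⟨hu.1, h1⟩]
  have := tendsto_setIntegral_circle hX hY h hA p
  simp only [hp, hint, integral_complex_ofReal] at this
  rw [← Complex.ofReal_mul] at this
  exact (Complex.continuous_re.tendsto _).comp this

theorem tendsto_setIntegral_fract {Ω : Type*} [MeasurableSpace Ω] {P : Measure Ω}
    [IsProbabilityMeasure P] {X Y : Ω → ℝ} (hX : Measurable X) (hY : Measurable Y)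
    (h : Tendsto (fun u : ℝ => ∫ ω, Complex.exp (Complex.I * (u * X ω)) ∂P)
      (cocompact ℝ) (nhds 0)) {A : Set Ω} (hA : MeasurableSet A) {f : ℝ → ℝ}
    (hf : Continuous f) :
    Tendsto (fun n : ℕ => ∫ ω in A, f (Int.fract ((n : ℝ) * X ω + Y ω)) ∂P)
      atTop (nhds (P.real A * ∫ u in (0 : ℝ)..1, f u)) := by
  obtain ⟨C, hC⟩ := (isCompact_Icc (a := (0 : ℝ)) (b := 1)).exists_bound_of_continuousOn
    hf.continuousOn
  have hC0 : 0 ≤ C := (norm_nonneg _).trans (hC 0 (by simp))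
  have hi : ∀ {g : ℝ → ℝ}, Continuous g → ∀ n : ℕ, Integrable
      (fun ω => g (Int.fract ((n : ℝ) * X ω + Y ω))) (P.restrict A) := fun {g} hg n => by
    obtain ⟨D, hD⟩ := (isCompact_Icc (a := (0 : ℝ)) (b := 1)).exists_bound_of_continuousOn
      hg.continuousOn
    refine Integrable.of_bound (C := D) (hg.measurable.comp
      (measurable_fract.comp (by fun_prop))).aestronglyMeasurable (ae_of_all _ fun ω => ?_)
    exact hD _ ⟨Int.fract_nonneg _, (Int.fract_lt_one _).le⟩
  -- the weight `(2 * u - 1) ^ (2 * N)` equals one at both endpoints and has small integral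
  have hw : ∀ N : ℕ, ∫ u in (0 : ℝ)..1, (2 * u - 1) ^ (2 * N) = 1 / (2 * N + 1 : ℝ) := fun N => by
    rw [intervalIntegral.integral_comp_mul_sub (fun u : ℝ => u ^ (2 * N)) two_ne_zero, integral_pow]
    have : Odd (2 * N + 1) := ⟨N, rfl⟩
    simp only [mul_one, mul_zero, zero_sub, this.neg_one_pow]
    norm_num
    field_simp
  have hPA : P.real A ≤ 1 := measureReal_le_one
  refine Metric.tendsto_atTop.2 fun ε hε => ?_
  obtain ⟨N, hN⟩ : ∃ N : ℕ, C * (1 / (2 * N + 1 : ℝ)) < ε / 4 := by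
    obtain ⟨N, hN⟩ := exists_nat_gt (4 * C / ε)
    refine ⟨N, ?_⟩
    rw [div_lt_iff₀ hε] at hN
    rw [mul_one_div, div_lt_iff₀ (by positivity)]
    nlinarith
  let w : ℝ → ℝ := fun u => C * (2 * u - 1) ^ (2 * N)
  let g : ℝ → ℝ := fun u => f u * (1 - (2 * u - 1) ^ (2 * N))
  have hwc : Continuous w := by fun_prop
  have hgc : Continuous g := by fun_prop
  have hwi : ∫ u in (0 : ℝ)..1, w u = C * (1 / (2 * N + 1 : ℝ)) := by
    rw [intervalIntegral.integral_const_mul, hw]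
  have hfg : ∀ u ∈ Set.Icc (0 : ℝ) 1, ‖f u - g u‖ ≤ w u := fun u hu => by
    have hnn : 0 ≤ (2 * u - 1) ^ (2 * N) := (even_two_mul N).pow_nonneg _
    have : f u - g u = f u * (2 * u - 1) ^ (2 * N) := by simp only [g]; ring
    rw [this, norm_mul, Real.norm_of_nonneg hnn]
    exact mul_le_mul_of_nonneg_right (hC u hu) hnn
  have tw := tendsto_setIntegral_fract_of_eq hX hY h hA hwc
    (by simp [w, (even_two_mul N).neg_one_pow]; norm_num)
  have tg := tendsto_setIntegral_fract_of_eq hX hY h hA hgc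
    (by simp [g, (even_two_mul N).neg_one_pow]; norm_num)
  rw [hwi] at tw
  have hlt : P.real A * (C * (1 / (2 * N + 1 : ℝ))) < ε / 4 :=
    (mul_le_of_le_one_left (by positivity) hPA).trans_lt hN
  obtain ⟨n₀, hn₀⟩ := eventually_atTop.1
    ((tw.eventually (gt_mem_nhds hlt)).and (Metric.tendsto_nhds.1 tg (ε / 4) (by positivity)))
  refine ⟨n₀, fun n hn => ?_⟩
  obtain ⟨h1, h2⟩ := hn₀ n hn
  have h3 : ‖(∫ ω in A, f (Int.fract ((n : ℝ) * X ω + Y ω)) ∂P) -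
      ∫ ω in A, g (Int.fract ((n : ℝ) * X ω + Y ω)) ∂P‖ ≤
      ∫ ω in A, w (Int.fract ((n : ℝ) * X ω + Y ω)) ∂P := by
    rw [← integral_sub (hi hf n) (hi hgc n)]
    exact norm_integral_le_of_norm_le (hi hwc n) (ae_of_all _ fun ω =>
      hfg _ ⟨Int.fract_nonneg _, (Int.fract_lt_one _).le⟩)
  have h4 : ‖(P.real A * ∫ u in (0 : ℝ)..1, g u) - P.real A * ∫ u in (0 : ℝ)..1, f u‖ < ε / 4 := by
    rw [← mul_sub, ← intervalIntegral.integral_sub (hgc.intervalIntegrable _ _)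
      (hf.intervalIntegrable _ _), norm_mul, Real.norm_of_nonneg measureReal_nonneg]
    refine lt_of_le_of_lt (mul_le_of_le_one_left (norm_nonneg _) hPA) (lt_of_le_of_lt ?_ hN)
    rw [← hwi]
    refine intervalIntegral.norm_integral_le_of_norm_le zero_le_one (ae_of_all _ fun u hu => ?_)
      (hwc.intervalIntegrable _ _)
    rw [norm_sub_rev]
    exact hfg u ⟨hu.1.le, hu.2⟩
  rw [dist_eq_norm] at h2 ⊢
  rw [Real.norm_eq_abs, abs_lt] at *
  rw [abs_le] at h3
  constructor <;> linarith [h3.1, h3.2]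

theorem tendsto_integral_fract_of_rajchman {Ω T : Type*} [MeasurableSpace Ω] {P : Measure Ω}
    [IsProbabilityMeasure P] [TopologicalSpace T] [TopologicalSpace.PseudoMetrizableSpace T]
    [SecondCountableTopology T] [MeasurableSpace T] [BorelSpace T]
    {X Y : Ω → ℝ} {W : Ω → T} (hX : Measurable X) (hY : Measurable Y) (hW : Measurable W)
    (h : Tendsto (fun u : ℝ => ∫ ω, Complex.exp (Complex.I * (u * X ω)) ∂P)
      (cocompact ℝ) (nhds 0)) (F : BoundedContinuousFunction (ℝ × T) ℝ) :
    Tendsto (fun n : ℕ => ∫ ω, F (Int.fract ((n : ℝ) * X ω + Y ω), W ω) ∂P) atTop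
      (nhds (∫ ω, (∫ u in Set.Icc (0 : ℝ) 1, F (u, W ω)) ∂P)) := by
  let G : C(T, C(unitInterval, ℝ)) :=
    ContinuousMap.curry ⟨fun z => F ((z.2 : ℝ), z.1), by fun_prop⟩
  have hG : Integrable (fun ω => G (W ω)) P := by
    refine Integrable.of_bound (C := ‖F‖)
      (G.continuous.comp_aestronglyMeasurable hW.aestronglyMeasurable) (ae_of_all _ fun ω => ?_)
    exact (ContinuousMap.norm_le _ (norm_nonneg _)).2 fun u => F.norm_coe_le_norm _
  let v : ℕ → Ω → unitInterval := fun n ω =>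
    ⟨Int.fract ((n : ℝ) * X ω + Y ω), Int.fract_nonneg _, (Int.fract_lt_one _).le⟩
  have hv : ∀ n, Measurable (v n) := fun n =>
    (measurable_fract.comp (by fun_prop)).subtype_mk
  have key := tendsto_integral_eval (μ := (volume : Measure unitInterval)) hv (fun q A hA => ?_) hG
  · have hlim : ∀ ω, ∫ u in Set.Icc (0 : ℝ) 1, F (u, W ω) = ∫ u : unitInterval, G (W ω) u :=
      fun ω => (integral_subtype_comap measurableSet_Icc fun u : ℝ => F (u, W ω)).symm
    simp only [hlim]
    exact key
  · have hq : ∀ u : unitInterval, Set.IccExtend zero_le_one q u = q u := fun u =>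
      Set.IccExtend_val _ _ _
    have hint : ∫ u in (0 : ℝ)..1, Set.IccExtend zero_le_one q u = ∫ u, q u := by
      rw [intervalIntegral.integral_of_le zero_le_one, ← integral_Icc_eq_integral_Ioc,
        ← integral_subtype_comap measurableSet_Icc]
      exact integral_congr_ae (ae_of_all _ hq)
    rw [← hint]
    refine (tendsto_setIntegral_fract hX hY h hA (q.continuous.Icc_extend' (h := zero_le_one))).congr
      fun n => ?_
    exact integral_congr_ae (ae_of_all _ fun ω => hq (v n ω))

theorem uniformContinuous_integral_exp {Ω : Type*} [MeasurableSpace Ω] {P : Measure Ω}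
    [IsProbabilityMeasure P] {X : Ω → ℝ} (hX : Measurable X) :
    UniformContinuous (fun u : ℝ => ∫ ω, Complex.exp (Complex.I * (u * X ω)) ∂P) := by
  have hi : ∀ u : ℝ, Integrable (fun ω => Complex.exp (Complex.I * (u * X ω))) P := fun u =>
    Integrable.of_bound (C := 1) (by fun_prop) (ae_of_all _ fun ω => by simp [Complex.norm_exp])
  have hcont : Tendsto (fun t : ℝ => ∫ ω, ‖Complex.exp (Complex.I * (t * X ω)) - 1‖ ∂P)
      (nhds 0) (nhds 0) := by
    have : Continuous (fun t : ℝ => ∫ ω, ‖Complex.exp (Complex.I * (t * X ω)) - 1‖ ∂P) := by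
      refine continuous_of_dominated (bound := fun _ => 2) (fun t => by fun_prop)
        (fun t => ae_of_all _ fun ω => ?_) (integrable_const _) (ae_of_all _ fun ω => by fun_prop)
      rw [norm_norm]
      refine (norm_sub_le _ _).trans ?_
      simp [Complex.norm_exp]
      norm_num
    simpa using this.tendsto 0
  refine Metric.uniformContinuous_iff.2 fun ε hε => ?_
  obtain ⟨δ, hδ, hδ'⟩ := Metric.tendsto_nhds_nhds.1 hcont ε hε
  refine ⟨δ, hδ, fun {a b} hab => ?_⟩
  have hlt := hδ' (x := a - b) (by simpa [Real.dist_eq] using hab)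
  rw [Real.dist_eq, sub_zero] at hlt
  rw [dist_eq_norm, ← integral_sub (hi a) (hi b)]
  refine (norm_integral_le_integral_norm _).trans_lt ((le_of_eq ?_).trans_lt
    ((le_abs_self _).trans_lt hlt))
  refine integral_congr_ae (ae_of_all _ fun ω => ?_)
  have hfac : Complex.exp (Complex.I * (a * X ω)) - Complex.exp (Complex.I * (b * X ω)) =
      Complex.exp (Complex.I * (b * X ω)) *
        (Complex.exp (Complex.I * ((a - b : ℝ) * X ω)) - 1) := by
    rw [mul_sub, ← Complex.exp_add, mul_one]
    congr 2
    push_cast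
    ring
  simp only [hfac, norm_mul]
  simp [Complex.norm_exp]

theorem tendsto_atTop_zero_of_tendsto_add_nat_mul {E : Type*} [SeminormedAddCommGroup E]
    {φ : ℝ → E} (hφ : UniformContinuous φ) {c : ℝ} (hc : 0 < c)
    (h : ∀ s : ℝ, Tendsto (fun n : ℕ => φ (c * n + s)) atTop (nhds 0)) :
    Tendsto φ atTop (nhds 0) := by
  refine Metric.tendsto_nhds.2 fun ε hε => ?_
  obtain ⟨δ, hδ, hδ'⟩ := Metric.uniformContinuous_iff.1 hφ (ε / 2) (half_pos hε)
  obtain ⟨t, -, ht, hcov⟩ := finite_cover_balls_of_compact (isCompact_Icc (a := 0) (b := c)) hδ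
  have hev : ∀ᶠ n : ℕ in atTop, ∀ s ∈ t, dist (φ (c * n + s)) 0 < ε / 2 :=
    (eventually_all_finite ht).2 fun s _ => Metric.tendsto_nhds.1 (h s) _ (half_pos hε)
  have hfl : Tendsto (fun u : ℝ => ⌊u / c⌋₊) atTop atTop :=
    tendsto_nat_floor_atTop.comp (tendsto_id.atTop_div_const hc)
  filter_upwards [hfl.eventually hev, eventually_ge_atTop 0] with u hu hu0
  have h1 : ((⌊u / c⌋₊ : ℕ) : ℝ) ≤ u / c := Nat.floor_le (by positivity)
  have h2 := Nat.lt_floor_add_one (u / c)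
  rw [le_div_iff₀ hc] at h1
  rw [div_lt_iff₀ hc] at h2
  have hmem : u - c * ⌊u / c⌋₊ ∈ Set.Icc 0 c := ⟨by linarith, by linarith⟩
  obtain ⟨s, hs, hsu⟩ := Set.mem_iUnion₂.1 (hcov hmem)
  have h3 : dist (φ u) (φ (c * ⌊u / c⌋₊ + s)) < ε / 2 := by
    refine hδ' ?_
    rw [Metric.mem_ball, Real.dist_eq] at hsu
    rwa [Real.dist_eq, ← sub_sub]
  linarith [dist_triangle (φ u) (φ (c * ⌊u / c⌋₊ + s)) 0, hu s hs]

theorem rajchman_of_tendsto_atTop {Ω : Type*} [MeasurableSpace Ω] {P : Measure Ω} {X : Ω → ℝ}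
    (h : Tendsto (fun u : ℝ => ∫ ω, Complex.exp (Complex.I * (u * X ω)) ∂P) atTop (nhds 0)) :
    Tendsto (fun u : ℝ => ∫ ω, Complex.exp (Complex.I * (u * X ω)) ∂P)
      (cocompact ℝ) (nhds 0) := by
  rw [cocompact_eq_atBot_atTop]
  refine Tendsto.sup ?_ h
  have := (Complex.continuous_conj.tendsto 0).comp (h.comp tendsto_neg_atBot_atTop)
  rw [map_zero] at this
  refine this.congr fun u => ?_
  simp only [Function.comp_apply]
  rw [← integral_conj]
  refine integral_congr_ae (ae_of_all _ fun ω => ?_)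
  simp only [← Complex.exp_conj]
  simp

theorem integral_Icc_cos_add (c : ℝ) :
    ∫ u in Set.Icc (0 : ℝ) 1, Real.cos (2 * Real.pi * u + c) = 0 := by
  rw [integral_Icc_eq_integral_Ioc, ← intervalIntegral.integral_of_le zero_le_one,
    intervalIntegral.integral_comp_mul_add (fun u => Real.cos u) (by positivity), integral_cos]
  simp [add_comm _ c]

theorem tendsto_integral_cos_of_tendsto {Ω : Type*} [MeasurableSpace Ω] {P : Measure Ω}
    {m : ℕ} {X Y : Ω → ℝ} {Z : Ω → (Fin m → ℝ)}
    (h : ∀ F : BoundedContinuousFunction (ℝ × ℝ × ℝ × (Fin m → ℝ)) ℝ,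
        Tendsto (fun n : ℕ =>
            ∫ ω, F (Int.fract ((n : ℝ) * X ω + Y ω), X ω, Y ω, Z ω) ∂P)
          atTop
          (nhds (∫ ω, (∫ u in Set.Icc (0:ℝ) 1, F (u, X ω, Y ω, Z ω)) ∂P))) (s d : ℝ) :
    Tendsto (fun n : ℕ => ∫ ω, Real.cos ((2 * Real.pi * n + s) * X ω + d) ∂P)
      atTop (nhds 0) := by
  let F : BoundedContinuousFunction (ℝ × ℝ × ℝ × (Fin m → ℝ)) ℝ :=
    BoundedContinuousFunction.ofNormedAddCommGroup
      (fun z => Real.cos (2 * Real.pi * z.1 + (s * z.2.1 - 2 * Real.pi * z.2.2.1 + d)))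
      (by fun_prop) 1 fun z => Real.abs_cos_le_one _
  have hF := h F
  simp only [F, BoundedContinuousFunction.coe_ofNormedAddCommGroup, integral_Icc_cos_add,
    integral_zero] at hF
  refine hF.congr fun n => integral_congr_ae (ae_of_all _ fun ω => ?_)
  simp only
  rw [← Real.cos_sub_int_mul_two_pi _ (-⌊(n : ℝ) * X ω + Y ω⌋), Int.fract]
  congr 1
  push_cast
  ring

theorem rajchman_of_tendsto_integral_fract {Ω : Type*} [MeasurableSpace Ω] {P : Measure Ω}
    [IsProbabilityMeasure P] {m : ℕ} {X Y : Ω → ℝ} {Z : Ω → (Fin m → ℝ)} (hX : Measurable X)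
    (h : ∀ F : BoundedContinuousFunction (ℝ × ℝ × ℝ × (Fin m → ℝ)) ℝ,
        Tendsto (fun n : ℕ =>
            ∫ ω, F (Int.fract ((n : ℝ) * X ω + Y ω), X ω, Y ω, Z ω) ∂P)
          atTop
          (nhds (∫ ω, (∫ u in Set.Icc (0:ℝ) 1, F (u, X ω, Y ω, Z ω)) ∂P))) :
    Tendsto (fun u : ℝ => ∫ ω, Complex.exp (Complex.I * (u * X ω)) ∂P)
      (cocompact ℝ) (nhds 0) := by
  refine rajchman_of_tendsto_atTop (tendsto_atTop_zero_of_tendsto_add_nat_mul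
    (uniformContinuous_integral_exp hX) Real.two_pi_pos fun s => ?_)
  have hcos := tendsto_integral_cos_of_tendsto h s 0
  have hsin := tendsto_integral_cos_of_tendsto h s (-(Real.pi / 2))
  have hsum := ((Complex.continuous_ofReal.tendsto 0).comp hcos).add
    (((Complex.continuous_ofReal.tendsto 0).comp hsin).mul_const Complex.I)
  simp only [Complex.ofReal_zero, zero_mul, add_zero] at hsum
  refine hsum.congr fun n => ?_
  have hi : ∀ d : ℝ, Integrable
      (fun ω => ((Real.cos ((2 * Real.pi * n + s) * X ω + d) : ℝ) : ℂ)) P := fun d =>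
    Integrable.of_bound (C := 1) (by fun_prop) (ae_of_all _ fun ω => by
      rw [Complex.norm_real]; exact Real.abs_cos_le_one _)
  have h0 := hi 0
  simp only [add_zero] at h0
  simp only [Function.comp_apply, ← integral_complex_ofReal]
  rw [← integral_mul_const, ← integral_add h0 ((hi _).mul_const _)]
  refine integral_congr_ae (ae_of_all _ fun ω => ?_)
  simp only [← sub_eq_add_neg, Real.cos_sub_pi_div_two]
  rw [mul_comm Complex.I, ← Complex.ofReal_mul, Complex.exp_mul_I]
  simp

/-- arbitrary functions principle: `({nX+Y}, X, Y, Z)` converges in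
distribution to `(U, X, Y, Z)` with `U` uniform on `[0,1]` independent of `(X,Y,Z)`,
if and only if the law of `X` is Rajchman (its characteristic function tends to `0`
at infinity). -/
theorem stmt3 {Ω : Type*} [MeasurableSpace Ω] (P : Measure Ω) [IsProbabilityMeasure P]
    {m : ℕ} (X Y : Ω → ℝ) (Z : Ω → (Fin m → ℝ))
    (hX : Measurable X) (hY : Measurable Y) (hZ : Measurable Z) :
    (∀ F : BoundedContinuousFunction (ℝ × ℝ × ℝ × (Fin m → ℝ)) ℝ,
        Tendsto (fun n : ℕ =>
            ∫ ω, F (Int.fract ((n : ℝ) * X ω + Y ω), X ω, Y ω, Z ω) ∂P)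
          atTop
          (nhds (∫ ω, (∫ u in Set.Icc (0:ℝ) 1, F (u, X ω, Y ω, Z ω)) ∂P))) ↔
      Tendsto (fun u : ℝ => ∫ ω, Complex.exp (Complex.I * (u * X ω)) ∂P)
        (cocompact ℝ) (nhds 0) := by
  exact ⟨rajchman_of_tendsto_integral_fract hX,
    tendsto_integral_fract_of_rajchman hX hY (hX.prodMk (hY.prodMk hZ))⟩
end

section
/- Let Y be an ℝ^d-valued random variable whose law is Rajchman (characteristic function E[e^{i⟨u,Y⟩}] → 0 as |u| → ∞), and set Y_n = Y + (1/n)θ(nY) with θ(y) = (1/2 - {y₁}, ..., 1/2 - {y_d}) (rounding each coordinate to the nearest multiple of 1/n). Then for any ℝ^m-valued random variable X on the same space, (X, n(Y_n - Y)) converges in distribution to (X, (V₁,...,V_d)) where V₁,...,V_d are i.i.d. uniform on (-1/2, 1/2), independent of X. -/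
open MeasureTheory Filter

/-- Componentwise rounding error function: `θ(y)_i = 1/2 − {yᵢ}`. -/
noncomputable def roundTheta {d : ℕ} (y : Fin d → ℝ) : Fin d → ℝ :=
  fun i => 1 / 2 - Int.fract (y i)

open Topology UnitAddTorus

/-- A bounded sequence in a Hilbert space that is asymptotically orthogonal to each of its own
terms tends weakly to zero. -/
theorem tendsto_inner_zero_of_tendsto_inner_self {H : Type*} [NormedAddCommGroup H]
    [InnerProductSpace ℂ H] [CompleteSpace H] {e : ℕ → H} (hb : ∀ n, ‖e n‖ ≤ 1)
    (h : ∀ m, Tendsto (fun n => inner ℂ (e m) (e n)) atTop (𝓝 0)) (z : H) :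
    Tendsto (fun n => inner ℂ z (e n)) atTop (𝓝 0) := by
  set V : Submodule ℂ H := (Submodule.span ℂ (Set.range e)).topologicalClosure with hV
  have heV (n : ℕ) : e n ∈ V :=
    Submodule.le_topologicalClosure _ (Submodule.subset_span ⟨n, rfl⟩)
  have : CompleteSpace V := (Submodule.isClosed_topologicalClosure _).completeSpace_coe
  have hclosed : IsClosed {w : H | Tendsto (fun n => inner ℂ w (e n)) atTop (𝓝 0)} := by
    refine Equicontinuous.isClosed_setOfPred_tendsto (F := fun n w => inner ℂ w (e n))
      (f := fun _ => 0) ?_ continuous_const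
    refine (LipschitzWith.uniformEquicontinuous _ 1 fun n => ?_).equicontinuous
    refine LipschitzWith.of_dist_le_mul fun x y => ?_
    rw [dist_eq_norm, dist_eq_norm, ← inner_sub_left, NNReal.coe_one, one_mul]
    exact (norm_inner_le_norm _ _).trans (mul_le_of_le_one_right (norm_nonneg _) (hb n))
  have hspan (w : H) (hw : w ∈ Submodule.span ℂ (Set.range e)) :
      Tendsto (fun n => inner ℂ w (e n)) atTop (𝓝 0) := by
    induction hw using Submodule.span_induction with
    | mem x hx => obtain ⟨m, rfl⟩ := hx; exact h m
    | zero => simp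
    | add x y _ _ hx hy => simpa [inner_add_left] using hx.add hy
    | smul a x _ hx => simpa [inner_smul_left] using hx.mul_const (starRingEnd ℂ a)
  have hcl : (V : Set H) ⊆ {w : H | Tendsto (fun n => inner ℂ w (e n)) atTop (𝓝 0)} := by
    rw [hV, Submodule.topologicalClosure_coe]
    exact closure_minimal hspan hclosed
  refine (hcl (V.starProjection_apply_mem z)).congr fun n => ?_
  rw [Submodule.inner_starProjection_left_eq_right,
    Submodule.starProjection_eq_self_iff.2 (heV n)]

/-- Asymptotic orthogonality of a sequence of random variables bounded by one to each of its terms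
forces its integrals over every event to vanish asymptotically. -/
theorem tendsto_setIntegral_zero_of_tendsto_integral_conj_mul {Ω : Type*} [MeasurableSpace Ω]
    (P : Measure Ω) [IsProbabilityMeasure P] {e : ℕ → Ω → ℂ} (he : ∀ n, Measurable (e n))
    (hb : ∀ n ω, ‖e n ω‖ ≤ 1)
    (h : ∀ m, Tendsto (fun n => ∫ ω, starRingEnd ℂ (e m ω) * e n ω ∂P) atTop (𝓝 0))
    {A : Set Ω} (hA : MeasurableSet A) :
    Tendsto (fun n => ∫ ω in A, e n ω ∂P) atTop (𝓝 0) := by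
  have hmem (n : ℕ) : MemLp (e n) 2 P :=
    .of_bound (he n).aestronglyMeasurable 1 (ae_of_all _ (hb n))
  have key := tendsto_inner_zero_of_tendsto_inner_self (e := fun n => (hmem n).toLp) ?_ ?_
    (indicatorConstLp 2 hA (measure_ne_top P A) (1 : ℂ))
  · refine key.congr fun n => ?_
    rw [L2.inner_indicatorConstLp_one]
    exact integral_congr_ae (ae_restrict_of_ae (hmem n).coeFn_toLp)
  · intro n
    have := Lp.norm_le_of_ae_bound (f := (hmem n).toLp) zero_le_one
      ((hmem n).coeFn_toLp.mono fun ω hω => by rw [hω]; exact hb n ω)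
    simpa [measureUnivNNReal] using this
  · intro m
    refine (h m).congr fun n => ?_
    rw [L2.inner_def]
    refine integral_congr_ae ?_
    filter_upwards [(hmem n).coeFn_toLp, (hmem m).coeFn_toLp] with ω h1 h2
    rw [h1, h2, RCLike.inner_apply, mul_comm]

/-- For a family `L ω` of `1`-Lipschitz functionals, `f ↦ ∫ L ω (f ω)` is `1`-Lipschitz
on `L¹`. -/
theorem lipschitzWith_integral_of_norm_sub_le {Ω E : Type*} [MeasurableSpace Ω] {P : Measure Ω}
    [NormedAddCommGroup E] {L : Ω → E → ℝ} (hL : ∀ ω f g, ‖L ω f - L ω g‖ ≤ ‖f - g‖)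
    (hint : ∀ f : Ω → E, Integrable f P → Integrable (fun ω => L ω (f ω)) P) :
    LipschitzWith 1 (fun f : Ω →₁[P] E => ∫ ω, L ω (f ω) ∂P) := by
  refine LipschitzWith.of_dist_le_mul fun f g => ?_
  have hf := L1.integrable_coeFn f
  have hg := L1.integrable_coeFn g
  rw [NNReal.coe_one, one_mul, dist_eq_norm, ← integral_sub (hint _ hf) (hint _ hg),
    L1.dist_eq_integral_dist]
  refine (norm_integral_le_integral_norm _).trans ?_
  refine integral_mono ((hint _ hf).sub (hint _ hg)).norm ?_ fun ω => ?_
  · simpa only [dist_eq_norm, Pi.sub_apply] using (hf.sub hg).norm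
  · simpa only [dist_eq_norm] using hL ω _ _

/-- Stable convergence tested on events and fixed continuous functions upgrades to integrable
random continuous functions. -/
theorem tendsto_integral_randomFunction {Ω T : Type*} [MeasurableSpace Ω]
    (P : Measure Ω) [IsProbabilityMeasure P] [MetricSpace T] [CompactSpace T] [MeasurableSpace T]
    [BorelSpace T] (ν : Measure T) [IsProbabilityMeasure ν] {τ : ℕ → Ω → T}
    (hτ : ∀ n, Measurable (τ n))
    (h : ∀ (f : C(T, ℝ)) (A : Set Ω), MeasurableSet A →
      Tendsto (fun n => ∫ ω in A, f (τ n ω) ∂P) atTop (𝓝 (P.real A * ∫ t, f t ∂ν)))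
    {G : Ω → C(T, ℝ)} (hG : Integrable G P) :
    Tendsto (fun n => ∫ ω, G ω (τ n ω) ∂P) atTop (𝓝 (∫ ω, ∫ t, G ω t ∂ν ∂P)) := by
  have hfint (f : C(T, ℝ)) : Integrable f ν := f.continuous.integrable_of_hasCompactSupport
    (HasCompactSupport.of_compactSpace f)
  have hν (f g : C(T, ℝ)) : ‖∫ t, f t ∂ν - ∫ t, g t ∂ν‖ ≤ ‖f - g‖ := by
    rw [← integral_sub (hfint f) (hfint g)]
    simpa using norm_integral_le_of_norm_le_const (μ := ν)
      (ae_of_all _ fun t => (f - g).norm_coe_le_norm t)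
  have hνc : Continuous fun f : C(T, ℝ) => ∫ t, f t ∂ν :=
    (LipschitzWith.of_dist_le_mul (K := 1) fun f g => by
      simpa [dist_eq_norm] using hν f g).continuous
  have hi (n : ℕ) (f : Ω → C(T, ℝ)) (hf : Integrable f P) :
      Integrable (fun ω => f ω (τ n ω)) P := by
    refine hf.norm.mono' ?_ (ae_of_all _ fun ω => (f ω).norm_coe_le_norm _)
    exact ContinuousEval.continuous_eval.comp_aestronglyMeasurable
      (hf.aestronglyMeasurable.prodMk (hτ n).aestronglyMeasurable)
  have hi' (f : Ω → C(T, ℝ)) (hf : Integrable f P) :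
      Integrable (fun ω => ∫ t, f ω t ∂ν) P := by
    refine hf.norm.mono' (hνc.comp_aestronglyMeasurable hf.aestronglyMeasurable)
      (ae_of_all _ fun ω => ?_)
    simpa using hν (f ω) 0
  refine Integrable.induction (μ := P) (fun G : Ω → C(T, ℝ) =>
    Tendsto (fun n => ∫ ω, G ω (τ n ω) ∂P) atTop (𝓝 (∫ ω, ∫ t, G ω t ∂ν ∂P))) ?_ ?_ ?_ ?_ hG
  · intro c s hs _
    have h1 (n : ℕ) : ∫ ω in s, c (τ n ω) ∂P = ∫ ω, (s.indicator (fun _ => c) ω) (τ n ω) ∂P := by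
      rw [← integral_indicator hs]
      congr 1 with ω
      by_cases hω : ω ∈ s <;> simp [hω]
    have h2 : P.real s * ∫ t, c t ∂ν = ∫ ω, ∫ t, (s.indicator (fun _ => c) ω) t ∂ν ∂P := by
      rw [← smul_eq_mul, ← setIntegral_const, ← integral_indicator hs]
      congr 1 with ω
      by_cases hω : ω ∈ s <;> simp [hω]
    rw [← h2]
    exact (h c s hs).congr h1
  · intro f g _ hf hg h1 h2
    have e1 (n : ℕ) : ∫ ω, (f + g) ω (τ n ω) ∂P
        = ∫ ω, f ω (τ n ω) ∂P + ∫ ω, g ω (τ n ω) ∂P := by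
      rw [← integral_add (hi n f hf) (hi n g hg)]; rfl
    have e2 : ∫ ω, ∫ t, (f + g) ω t ∂ν ∂P = ∫ ω, ∫ t, f ω t ∂ν ∂P + ∫ ω, ∫ t, g ω t ∂ν ∂P := by
      rw [← integral_add (hi' f hf) (hi' g hg)]
      congr 1 with ω
      exact integral_add (hfint _) (hfint _)
    simp only [e1, e2]
    exact h1.add h2
  · refine Equicontinuous.isClosed_setOfPred_tendsto
      (F := fun n (f : Ω →₁[P] C(T, ℝ)) => ∫ ω, f ω (τ n ω) ∂P)
      (f := fun f : Ω →₁[P] C(T, ℝ) => ∫ ω, ∫ t, f ω t ∂ν ∂P) ?_ ?_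
    · refine (LipschitzWith.uniformEquicontinuous _ 1 fun n => ?_).equicontinuous
      exact lipschitzWith_integral_of_norm_sub_le (L := fun ω (f : C(T, ℝ)) => f (τ n ω))
        (fun ω f g => (f - g).norm_coe_le_norm _) (hi n)
    · exact (lipschitzWith_integral_of_norm_sub_le (L := fun _ (f : C(T, ℝ)) => ∫ t, f t ∂ν)
        (fun _ => hν) hi').continuous
  · intro f g hfg _ h1
    have e1 (n : ℕ) : ∫ ω, f ω (τ n ω) ∂P = ∫ ω, g ω (τ n ω) ∂P :=
      integral_congr_ae (hfg.mono fun ω hω => by simp only [hω])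
    have e2 : ∫ ω, ∫ t, f ω t ∂ν ∂P = ∫ ω, ∫ t, g ω t ∂ν ∂P :=
      integral_congr_ae (hfg.mono fun ω hω => by simp only [hω])
    rw [← e2]
    exact h1.congr e1

/-- The canonical projection `ℝᵈ → (ℝ/ℤ)ᵈ`. -/
noncomputable def torusMk {d : ℕ} (v : Fin d → ℝ) : UnitAddTorus (Fin d) :=
  fun i => (v i : UnitAddCircle)

theorem continuous_torusMk {d : ℕ} : Continuous (torusMk (d := d)) :=
  continuous_pi fun i => (AddCircle.continuous_mk' 1).comp (continuous_apply i)

/-- The open unit cube centred at the origin. -/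
abbrev unitCube (d : ℕ) : Set (Fin d → ℝ) :=
  Set.univ.pi fun _ : Fin d => Set.Ioo (-(1/2) : ℝ) (1/2)

theorem mFourier_torusMk {d : ℕ} (k : Fin d → ℤ) (v : Fin d → ℝ) :
    mFourier k (torusMk v) = Complex.exp (2 * Real.pi * Complex.I * ∑ i, k i * v i) := by
  simp only [mFourier, torusMk, ContinuousMap.coe_mk, fourier_coe_apply, ← Complex.exp_sum]
  push_cast
  rw [Finset.mul_sum]
  congr 1
  refine Finset.sum_congr rfl fun i _ => ?_
  ring

instance isProbabilityMeasure_restrict_unitCube (d : ℕ) :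
    IsProbabilityMeasure ((volume : Measure (Fin d → ℝ)).restrict (unitCube d)) := by
  constructor
  rw [Measure.restrict_apply_univ, volume_pi_pi]
  norm_num

theorem integral_mFourier_unitCube {d : ℕ} {k : Fin d → ℤ} (hk : k ≠ 0) :
    ∫ v in unitCube d, mFourier k (torusMk v) = 0 := by
  rw [volume_pi, Measure.restrict_pi_pi]
  simp only [mFourier, torusMk, ContinuousMap.coe_mk]
  rw [integral_fintype_prod_eq_prod (fun i (x : ℝ) => fourier (k i) (x : UnitAddCircle))]
  obtain ⟨i, hi⟩ := Function.ne_iff.1 hk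
  refine Finset.prod_eq_zero (Finset.mem_univ i) ?_
  rw [← integral_Ioc_eq_integral_Ioo, ← intervalIntegral.integral_of_le (by norm_num)]
  have hc : (2 * Real.pi * Complex.I * k i : ℂ) ≠ 0 := by
    simpa using hi
  have : ∀ x : ℝ, fourier (k i) (x : UnitAddCircle)
      = Complex.exp ((2 * Real.pi * Complex.I * k i) * x) := fun x => by
    rw [fourier_coe_apply]; simp
  simp_rw [this]
  rw [integral_exp_mul_complex hc, div_eq_zero_iff, sub_eq_zero]
  left
  rw [Complex.exp_eq_exp_iff_exists_int]
  exact ⟨k i, by push_cast; ring⟩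

/-- Weyl's criterion on the torus, localized to an event. -/
theorem tendsto_setIntegral_torus {Ω : Type*} [MeasurableSpace Ω] (P : Measure Ω)
    [IsProbabilityMeasure P] {d : ℕ} {τ : ℕ → Ω → UnitAddTorus (Fin d)}
    (hτ : ∀ n, Measurable (τ n)) {A : Set Ω}
    (h : ∀ k : Fin d → ℤ, k ≠ 0 → Tendsto (fun n => ∫ ω in A, mFourier k (τ n ω) ∂P) atTop (𝓝 0))
    (f : C(UnitAddTorus (Fin d), ℝ)) :
    Tendsto (fun n => ∫ ω in A, f (τ n ω) ∂P) atTop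
      (𝓝 (P.real A * ∫ v in unitCube d, f (torusMk v))) := by
  have hint (μ : Measure Ω) [IsFiniteMeasure μ] (n : ℕ) (g : C(UnitAddTorus (Fin d), ℂ)) :
      Integrable (fun ω => g (τ n ω)) μ :=
    .of_bound (g.continuous.measurable.comp (hτ n)).aestronglyMeasurable ‖g‖
      (ae_of_all _ fun ω => g.norm_coe_le_norm _)
  have hint' (g : C(UnitAddTorus (Fin d), ℂ)) :
      Integrable (fun v => g (torusMk v)) (volume.restrict (unitCube d)) :=
    .of_bound (g.continuous.comp continuous_torusMk).aestronglyMeasurable ‖g‖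
      (ae_of_all _ fun ω => g.norm_coe_le_norm _)
  suffices H : ∀ g : C(UnitAddTorus (Fin d), ℂ),
      Tendsto (fun n => ∫ ω in A, g (τ n ω) ∂P) atTop
        (𝓝 (P.real A * ∫ v in unitCube d, g (torusMk v))) by
    have := H ((⟨Complex.ofReal, Complex.continuous_ofReal⟩ : C(ℝ, ℂ)).comp f)
    simp only [ContinuousMap.comp_apply, ContinuousMap.coe_mk, integral_complex_ofReal] at this
    exact_mod_cast (Complex.continuous_re.tendsto _).comp this
  have hclosed : IsClosed {g : C(UnitAddTorus (Fin d), ℂ) |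
      Tendsto (fun n => ∫ ω in A, g (τ n ω) ∂P) atTop
        (𝓝 (P.real A * ∫ v in unitCube d, g (torusMk v)))} := by
    refine Equicontinuous.isClosed_setOfPred_tendsto
      (F := fun n (g : C(UnitAddTorus (Fin d), ℂ)) => ∫ ω in A, g (τ n ω) ∂P)
      (f := fun g => P.real A * ∫ v in unitCube d, g (torusMk v)) ?_ ?_
    · refine (LipschitzWith.uniformEquicontinuous _ 1 fun n => ?_).equicontinuous
      refine LipschitzWith.of_dist_le_mul fun f g => ?_
      rw [dist_eq_norm, dist_eq_norm, ← integral_sub (hint _ n f) (hint _ n g)]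
      have := norm_integral_le_of_norm_le_const (μ := P.restrict A)
        (ae_of_all _ fun ω => (f - g).norm_coe_le_norm (τ n ω))
      refine this.trans ?_
      rw [mul_comm, NNReal.coe_one]
      gcongr
      simp
    · refine continuous_const.mul (LipschitzWith.of_dist_le_mul (K := 1) fun f g => ?_).continuous
      rw [dist_eq_norm, dist_eq_norm, ← integral_sub (hint' f) (hint' g)]
      simpa using norm_integral_le_of_norm_le_const (μ := volume.restrict (unitCube d))
        (ae_of_all _ fun v => (f - g).norm_coe_le_norm (torusMk v))
  intro g
  have hg : g ∈ (Submodule.span ℂ (Set.range (mFourier (d := Fin d)))).topologicalClosure := by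
    rw [span_mFourier_closure_eq_top]; trivial
  refine closure_minimal (fun g hg => ?_) hclosed hg
  induction hg using Submodule.span_induction with
  | mem x hx =>
    obtain ⟨k, rfl⟩ := hx
    by_cases hk : k = 0
    · subst hk
      simp [mFourier_zero]
    · simpa [integral_mFourier_unitCube hk] using h k hk
  | zero => simp
  | add x y _ _ hx hy =>
    simp only [Set.mem_ofPred_eq, ContinuousMap.add_apply] at hx hy ⊢
    rw [integral_add (hint' x) (hint' y), mul_add]
    refine (hx.add hy).congr fun n => ?_
    rw [integral_add (hint _ n x) (hint _ n y)]
  | smul a x _ hx =>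
    simp only [Set.mem_ofPred_eq, ContinuousMap.smul_apply, integral_smul] at hx ⊢
    rw [mul_smul_comm]
    exact hx.const_smul a

/-- The Fourier modes of `n ↦ 1/2 - nY` on the torus are asymptotically null on every event when
the law of `Y` is Rajchman. -/
theorem tendsto_setIntegral_mFourier_of_rajchman {Ω : Type*} [MeasurableSpace Ω] (P : Measure Ω)
    [IsProbabilityMeasure P] {d : ℕ} {Y : Ω → (Fin d → ℝ)} (hY : Measurable Y)
    (hRaj : Tendsto (fun u : Fin d → ℝ =>
        ∫ ω, Complex.exp (Complex.I * (∑ i, u i * Y ω i)) ∂P) (cocompact (Fin d → ℝ)) (𝓝 0))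
    {k : Fin d → ℤ} (hk : k ≠ 0) {A : Set Ω} (hA : MeasurableSet A) :
    Tendsto (fun n : ℕ => ∫ ω in A, mFourier k (torusMk fun i => 1 / 2 - n * Y ω i) ∂P)
      atTop (𝓝 0) := by
  refine tendsto_setIntegral_zero_of_tendsto_integral_conj_mul P (fun n => ?_) (fun n ω => ?_)
    (fun m => ?_) hA
  · refine (mFourier k).continuous.measurable.comp (continuous_torusMk.measurable.comp ?_)
    fun_prop
  · exact ((mFourier k).norm_coe_le_norm _).trans mFourier_norm.le
  · have hu : Tendsto (fun n : ℕ => (2 * Real.pi * ((m : ℝ) - n)) • (fun i => (k i : ℝ))) atTop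
        (cocompact (Fin d → ℝ)) := by
      rw [← Metric.cobounded_eq_cocompact, ← tendsto_norm_atTop_iff_cobounded]
      simp only [norm_smul]
      refine Tendsto.atTop_mul_const (norm_pos_iff.2 ?_) ?_
      · intro h0
        exact hk (funext fun i => by simpa using congrFun h0 i)
      · refine tendsto_abs_atBot_atTop.comp (Tendsto.const_mul_atBot (by positivity) ?_)
        simpa [sub_eq_add_neg] using tendsto_atBot_add_const_left atTop (m : ℝ)
          (tendsto_neg_atTop_atBot.comp tendsto_natCast_atTop_atTop)
    refine (hRaj.comp hu).congr fun n => ?_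
    refine integral_congr_ae (ae_of_all _ fun ω => ?_)
    dsimp only
    rw [← mFourier_neg, mFourier_torusMk, mFourier_torusMk, ← Complex.exp_add, ← mul_add,
      ← Complex.ofReal_add, ← Finset.sum_add_distrib]
    congr 1
    push_cast
    rw [Finset.mul_sum, Finset.mul_sum]
    refine Finset.sum_congr rfl fun i _ => ?_
    simp only [Pi.neg_apply, Pi.smul_apply, smul_eq_mul]
    push_cast
    ring

/-- The representative in `(-1/2, 1/2]ᵈ` of a point of the torus. -/
noncomputable def torusRep {d : ℕ} (t : UnitAddTorus (Fin d)) : Fin d → ℝ :=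
  fun i => (AddCircle.equivIoc (1 : ℝ) (-(1 / 2)) (t i) : ℝ)

theorem torusRep_torusMk {d : ℕ} {v : Fin d → ℝ} (hv : v ∈ Set.univ.pi fun _ : Fin d =>
    Set.Ioc (-(1 / 2) : ℝ) (1 / 2)) : torusRep (torusMk v) = v := by
  funext i
  refine AddCircle.equivIoc_coe_of_mem ?_
  have := hv i trivial
  exact ⟨this.1, this.2.trans (by norm_num)⟩

/-- The points of the torus none of whose coordinates is the discontinuity `-1/2` of
`torusRep`. -/
def torusRegular (d : ℕ) : Set (UnitAddTorus (Fin d)) :=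
  {t | ∀ i, t i ≠ ((-(1 / 2) : ℝ) : UnitAddCircle)}

theorem isOpen_torusRegular (d : ℕ) : IsOpen (torusRegular d) := by
  simp only [torusRegular, Set.ofPred_forall]
  exact isOpen_iInter_of_finite fun i => isOpen_ne.preimage (continuous_apply i)

theorem continuousAt_torusRep {d : ℕ} {t : UnitAddTorus (Fin d)} (ht : t ∈ torusRegular d) :
    ContinuousAt torusRep t :=
  continuousAt_pi.2 fun i => continuous_subtype_val.continuousAt.comp
    (ContinuousAt.comp (f := fun s : UnitAddTorus (Fin d) => s i)
      (AddCircle.continuousAt_equivIoc (1 : ℝ) (-(1 / 2)) (ht i))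
      (continuous_apply i).continuousAt)

theorem torusMk_mem_torusRegular {d : ℕ} {v : Fin d → ℝ} (hv : v ∈ unitCube d) :
    torusMk v ∈ torusRegular d := by
  intro i hi
  have h1 := hv i trivial
  have h2 : (-(1 / 2) : ℝ) + 1 ∈ Set.Ioc (-(1 / 2) : ℝ) (-(1 / 2) + 1) := by norm_num
  have h3 : v i ∈ Set.Ioc (-(1 / 2) : ℝ) (-(1 / 2) + 1) :=
    ⟨h1.1, h1.2.le.trans (by norm_num)⟩
  have h4 : (v i : UnitAddCircle) = ((-(1 / 2) + 1 : ℝ) : UnitAddCircle) := by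
    rw [AddCircle.coe_add, AddCircle.coe_period, add_zero]; exact hi
  have h5 := (AddCircle.coe_eq_coe_iff_of_mem_Ioc h3 h2).1 h4
  linarith [h1.2]

theorem roundTheta_eq_torusRep {d : ℕ} (y : Fin d → ℝ) :
    roundTheta y = torusRep (torusMk fun i => 1 / 2 - y i) := by
  have h : (torusMk fun i => 1 / 2 - y i) = torusMk (roundTheta y) := by
    funext i
    rw [torusMk, torusMk, ← sub_eq_zero, ← AddCircle.coe_sub, AddCircle.coe_eq_zero_iff]
    refine ⟨-⌊y i⌋, ?_⟩
    simp only [roundTheta, Int.fract, zsmul_eq_mul]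
    push_cast
    ring
  rw [h, torusRep_torusMk]
  intro i _
  have h0 := Int.fract_nonneg (y i)
  have h1 := Int.fract_lt_one (y i)
  constructor <;> simp only [roundTheta] <;> linarith

/-- The uniform law on the torus. -/
noncomputable def torusUniform (d : ℕ) : Measure (UnitAddTorus (Fin d)) :=
  (volume.restrict (unitCube d)).map torusMk

instance isProbabilityMeasure_torusUniform (d : ℕ) : IsProbabilityMeasure (torusUniform d) :=
  Measure.isProbabilityMeasure_map continuous_torusMk.aemeasurable

theorem integral_torusUniform {d : ℕ} {f : UnitAddTorus (Fin d) → ℝ} (hf : Continuous f) :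
    ∫ t, f t ∂torusUniform d = ∫ v in unitCube d, f (torusMk v) :=
  integral_map continuous_torusMk.aemeasurable hf.aestronglyMeasurable

/-- Weak convergence of joint laws on `ℝᵐ × (ℝ/ℤ)ᵈ` transfers to the representatives in the cube,
since the limit does not charge the discontinuities of `torusRep`. -/
theorem tendsto_map_torusRep {Ω : Type*} [MeasurableSpace Ω] (P : Measure Ω)
    [IsProbabilityMeasure P] {d m : ℕ} {X : Ω → (Fin m → ℝ)} (hX : Measurable X)
    {τ : ℕ → Ω → UnitAddTorus (Fin d)} (hτ : ∀ n, Measurable (τ n))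
    {V : ℕ → Ω → (Fin d → ℝ)} (hV : ∀ n, Measurable (V n))
    (hVτ : ∀ᶠ n in atTop, ∀ ω, V n ω = torusRep (τ n ω))
    (h : ∀ F : BoundedContinuousFunction ((Fin m → ℝ) × UnitAddTorus (Fin d)) ℝ,
      Tendsto (fun n => ∫ ω, F (X ω, τ n ω) ∂P) atTop
        (𝓝 (∫ ω, ∫ t, F (X ω, t) ∂torusUniform d ∂P)))
    (F : BoundedContinuousFunction ((Fin m → ℝ) × (Fin d → ℝ)) ℝ) :
    Tendsto (fun n => ∫ ω, F (X ω, V n ω) ∂P) atTop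
      (𝓝 (∫ ω, (∫ v in unitCube d, F (X ω, v)) ∂P)) := by
  have : IsProbabilityMeasure (P.map X) := Measure.isProbabilityMeasure_map hX.aemeasurable
  have hXτ (n : ℕ) : Measurable fun ω => (X ω, τ n ω) := hX.prodMk (hτ n)
  have hXV (n : ℕ) : Measurable fun ω => (X ω, V n ω) := hX.prodMk (hV n)
  let ρ (n : ℕ) : ProbabilityMeasure ((Fin m → ℝ) × UnitAddTorus (Fin d)) :=
    ⟨P.map fun ω => (X ω, τ n ω), Measure.isProbabilityMeasure_map (hXτ n).aemeasurable⟩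
  let ρ' : ProbabilityMeasure ((Fin m → ℝ) × UnitAddTorus (Fin d)) :=
    ⟨(P.map X).prod (torusUniform d), inferInstance⟩
  let κ (n : ℕ) : ProbabilityMeasure ((Fin m → ℝ) × (Fin d → ℝ)) :=
    ⟨P.map fun ω => (X ω, V n ω), Measure.isProbabilityMeasure_map (hXV n).aemeasurable⟩
  let κ' : ProbabilityMeasure ((Fin m → ℝ) × (Fin d → ℝ)) :=
    ⟨(P.map X).prod (volume.restrict (unitCube d)), inferInstance⟩
  have prod_integral {T : Type} [TopologicalSpace T] [SecondCountableTopology T]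
      [MeasurableSpace T] [BorelSpace T] (ν : Measure T) [IsProbabilityMeasure ν]
      (F : BoundedContinuousFunction ((Fin m → ℝ) × T) ℝ) :
      ∫ p, F p ∂((P.map X).prod ν) = ∫ ω, ∫ t, F (X ω, t) ∂ν ∂P := by
    rw [integral_prod _ (F.integrable _)]
    exact integral_map hX.aemeasurable
      (F.continuous.stronglyMeasurable.integral_prod_right').aestronglyMeasurable
  have hρ : Tendsto ρ atTop (𝓝 ρ') := by
    refine ProbabilityMeasure.tendsto_iff_forall_integral_tendsto.2 fun F => ?_
    change Tendsto _ _ (𝓝 (∫ p, F p ∂((P.map X).prod (torusUniform d))))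
    rw [prod_integral]
    refine (h F).congr fun n => ?_
    exact (integral_map (hXτ n).aemeasurable F.continuous.aestronglyMeasurable).symm
  have hκ : Tendsto κ atTop (𝓝 κ') := by
    refine tendsto_of_forall_isOpen_le_liminf' fun G hG => ?_
    set G' : Set ((Fin m → ℝ) × UnitAddTorus (Fin d)) :=
      {p | p.2 ∈ torusRegular d ∧ (p.1, torusRep p.2) ∈ G}
    have hG'o : IsOpen G' := by
      refine isOpen_iff_mem_nhds.2 fun p hp => ?_
      have h1 : ContinuousAt
          (fun p : (Fin m → ℝ) × UnitAddTorus (Fin d) => (p.1, torusRep p.2)) p :=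
        continuousAt_fst.prodMk ((continuousAt_torusRep hp.1).comp continuousAt_snd)
      exact inter_mem (continuousAt_snd ((isOpen_torusRegular d).mem_nhds hp.1))
        (h1 (hG.mem_nhds hp.2))
    calc ((P.map X).prod (volume.restrict (unitCube d))) G
        ≤ ((P.map X).prod (volume.restrict (unitCube d))) (Prod.map id torusMk ⁻¹' G') := by
          refine measure_mono_ae ?_
          have hae : ∀ᵐ p ∂((P.map X).prod (volume.restrict (unitCube d))),
              p.2 ∈ unitCube d :=
            Measure.quasiMeasurePreserving_snd.ae (ae_restrict_mem
              (MeasurableSet.univ_pi fun _ => measurableSet_Ioo))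
          filter_upwards [hae] with p hp hpG
          refine ⟨torusMk_mem_torusRegular hp, ?_⟩
          change (p.1, torusRep (torusMk p.2)) ∈ G
          rwa [torusRep_torusMk fun i hi => Set.Ioo_subset_Ioc_self (hp i hi)]
      _ = ((P.map X).prod (torusUniform d)) G' := by
          rw [torusUniform, ← Measure.map_id (μ := P.map X),
            Measure.map_prod_map _ _ measurable_id continuous_torusMk.measurable, Measure.map_id,
            Measure.map_apply (measurable_id.prodMap continuous_torusMk.measurable)
              hG'o.measurableSet]
      _ ≤ atTop.liminf fun n => (ρ n : Measure _) G' :=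
          ProbabilityMeasure.le_liminf_measure_open_of_tendsto hρ hG'o
      _ ≤ atTop.liminf fun n => (κ n : Measure _) G := by
          refine liminf_le_liminf (hVτ.mono fun n hn => ?_)
          change (P.map fun ω => (X ω, τ n ω)) G' ≤ (P.map fun ω => (X ω, V n ω)) G
          rw [Measure.map_apply (hXτ n) hG'o.measurableSet,
            Measure.map_apply (hXV n) hG.measurableSet]
          refine measure_mono fun ω hω => ?_
          change (X ω, V n ω) ∈ G
          rw [hn ω]
          exact hω.2
  have := ProbabilityMeasure.tendsto_iff_forall_integral_tendsto.1 hκ F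
  change Tendsto _ _ (𝓝 (∫ p, F p ∂((P.map X).prod (volume.restrict (unitCube d))))) at this
  rw [prod_integral] at this
  refine this.congr fun n => ?_
  exact integral_map (hXV n).aemeasurable F.continuous.aestronglyMeasurable

/-- If the law of `Y` is Rajchman, and `Y_n = Y + (1/n)θ(nY)` is the
rounding of `Y` to the nearest `1/n`-graduation, then for any random variable `X`,
`(X, n(Y_n − Y))` converges in law to `(X, V)` with `V` uniform on `(−1/2,1/2)^d`
independent of `X`. -/
theorem stmt4 {Ω : Type*} [MeasurableSpace Ω] (P : Measure Ω) [IsProbabilityMeasure P]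
    {d m : ℕ} (Y : Ω → (Fin d → ℝ)) (X : Ω → (Fin m → ℝ))
    (hY : Measurable Y) (hX : Measurable X)
    (hRaj : Tendsto (fun u : Fin d → ℝ =>
        ∫ ω, Complex.exp (Complex.I * (∑ i, u i * Y ω i))  ∂P)
      (cocompact (Fin d → ℝ)) (nhds 0))
    (Yn : ℕ → Ω → (Fin d → ℝ))
    (hYn : ∀ n ω, Yn n ω = Y ω + (1 / (n:ℝ)) • roundTheta ((n:ℝ) • Y ω)) :
    ∀ F : BoundedContinuousFunction ((Fin m → ℝ) × (Fin d → ℝ)) ℝ,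
      Tendsto (fun n : ℕ => ∫ ω, F (X ω, (n:ℝ) • (Yn n ω - Y ω)) ∂P)
        atTop
        (nhds (∫ ω, (∫ v in Set.univ.pi fun _ : Fin d => Set.Ioo (-(1/2) : ℝ) (1/2),
          F (X ω, v)) ∂P)) := by
  intro F
  let τ (n : ℕ) (ω : Ω) : UnitAddTorus (Fin d) := torusMk fun i => 1 / 2 - n * Y ω i
  have hτ (n : ℕ) : Measurable (τ n) := continuous_torusMk.measurable.comp (by fun_prop)
  have hfr (n : ℕ) : Measurable fun ω => roundTheta ((n : ℝ) • Y ω) :=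
    measurable_pi_lambda _ fun i => measurable_const.sub
      (measurable_fract.comp (((measurable_pi_apply i).comp hY).const_smul (n : ℝ)))
  refine tendsto_map_torusRep P hX hτ (V := fun n ω => (n : ℝ) • (Yn n ω - Y ω)) (fun n => ?_) ?_
    (fun F => ?_) F
  · simp only [hYn, add_sub_cancel_left]
    exact ((hfr n).const_smul (1 / (n : ℝ))).const_smul (n : ℝ)
  · filter_upwards [eventually_gt_atTop 0] with n hn ω
    have hn' : (n : ℝ) ≠ 0 := by positivity
    rw [hYn, add_sub_cancel_left, smul_smul, mul_one_div_cancel hn', one_smul,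
      roundTheta_eq_torusRep]
    rfl
  · let G : C(Fin m → ℝ, C(UnitAddTorus (Fin d), ℝ)) := F.toContinuousMap.curry
    have hG : Integrable (fun ω => G (X ω)) P := by
      refine .of_bound (G.continuous.comp_aestronglyMeasurable hX.aestronglyMeasurable) ‖F‖
        (ae_of_all _ fun ω => ?_)
      exact (ContinuousMap.norm_le _ (norm_nonneg _)).2 fun t => F.norm_coe_le_norm _
    refine tendsto_integral_randomFunction P (torusUniform d) hτ (fun f A hA => ?_) hG
    rw [integral_torusUniform f.continuous]
    exact tendsto_setIntegral_torus P hτ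
      (fun k hk => tendsto_setIntegral_mFourier_of_rajchman P hY hRaj hk hA) f
end

section
/- Let φ : ℝ^d → ℝ be of class C². Then the functions y ↦ n²(φ(y + (1/n)θ(ny)) - φ(y)), with θ(y) = (1/2 - {y₁},...,1/2 - {y_d}), converge in the sense of distributions (tested against smooth compactly supported functions with respect to Lebesgue measure) to (1/24) Δφ. -/
open MeasureTheory Filter

open scoped Topology

/-- Heine–Cantor with only one of the two points confined to the compact set. -/
theorem exists_forall_norm_sub_lt_of_continuous {α β : Type*} [PseudoMetricSpace α]
    [SeminormedAddCommGroup β] {f : α → β} (hf : Continuous f) {K : Set α} (hK : IsCompact K)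
    {ε : ℝ} (hε : 0 < ε) :
    ∃ δ > 0, ∀ x ∈ K, ∀ y, dist x y < δ → ‖f y - f x‖ < ε := by
  obtain ⟨δ, hδ, H⟩ := Metric.mem_uniformity_dist.1
    (hK.uniformContinuousAt_of_continuousAt f (fun _ _ => hf.continuousAt)
      (Metric.dist_mem_uniformity hε))
  exact ⟨δ, hδ, fun x hx y hxy => by
    rw [← dist_eq_norm, dist_comm]
    exact H hxy hx⟩

/-- Second-order Taylor expansion, uniform on compact sets. -/
theorem exists_forall_norm_sub_taylor_two_le {E : Type*} [NormedAddCommGroup E] [NormedSpace ℝ E]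
    {φ : E → ℝ} (hφ : ContDiff ℝ 2 φ) {K : Set E} (hK : IsCompact K) {ε : ℝ} (hε : 0 < ε) :
    ∃ δ > 0, ∀ y ∈ K, ∀ h : E, ‖h‖ < δ →
      ‖φ (y + h) - φ y - fderiv ℝ φ y h - (1 / 2) * fderiv ℝ (fderiv ℝ φ) y h h‖
        ≤ ε * ‖h‖ ^ 2 := by
  have hD : ContDiff ℝ 1 (fderiv ℝ φ) := hφ.fderiv_right (by norm_num)
  have hDd : Differentiable ℝ (fderiv ℝ φ) := hD.differentiable (by norm_num)
  have hφd : Differentiable ℝ φ := hφ.differentiable (by norm_num)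
  have hDD : Continuous (fderiv ℝ (fderiv ℝ φ)) := hD.continuous_fderiv (by norm_num)
  obtain ⟨δ, hδ, H⟩ := exists_forall_norm_sub_lt_of_continuous
    (β := E →L[ℝ] E →L[ℝ] ℝ) hDD hK hε
  refine ⟨δ, hδ, fun y hy h hh => ?_⟩
  have hfirst : ∀ t ∈ Set.Icc (0 : ℝ) 1,
      ‖fderiv ℝ φ (y + t • h) - fderiv ℝ φ y - fderiv ℝ (fderiv ℝ φ) y (t • h)‖ ≤ ε * ‖h‖ := by
    intro t ht
    have hth : ‖t • h‖ ≤ ‖h‖ := by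
      rw [norm_smul, Real.norm_of_nonneg ht.1]
      exact mul_le_of_le_one_left (norm_nonneg _) ht.2
    have := (convex_ball y δ).norm_image_sub_le_of_norm_fderiv_le' (𝕜 := ℝ) (f := fderiv ℝ φ)
      (φ := fderiv ℝ (fderiv ℝ φ) y) (C := ε) (x := y) (y := y + t • h)
      (fun x _ => hDd x) (fun x hx => ?_) (Metric.mem_ball_self hδ)
      (by rw [mem_ball_iff_norm]; simpa using hth.trans_lt hh)
    · rw [add_sub_cancel_left] at this
      exact this.trans (by gcongr)
    · exact (H y hy x (by rw [dist_comm]; exact hx)).le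
  have hline : ∀ t : ℝ, HasDerivAt (fun s : ℝ => y + s • h) h t := fun t => by
    simpa using ((hasDerivAt_id t).smul_const h).const_add y
  have hderiv : ∀ t : ℝ, HasDerivAt (fun s : ℝ => φ (y + s • h) - s * fderiv ℝ φ y h
      - (s ^ 2 / 2) * fderiv ℝ (fderiv ℝ φ) y h h)
      ((fderiv ℝ φ (y + t • h) - fderiv ℝ φ y - fderiv ℝ (fderiv ℝ φ) y (t • h)) h) t := by
    intro t
    have h1 := (hφd (y + t • h)).hasFDerivAt.comp_hasDerivAt t (hline t)
    have h2 := (hasDerivAt_id t).mul_const (fderiv ℝ φ y h)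
    have h3 := (((hasDerivAt_id t).pow 2).div_const 2).mul_const (fderiv ℝ (fderiv ℝ φ) y h h)
    refine ((h1.sub h2).sub h3).congr_deriv ?_
    simp
  have := norm_image_sub_le_of_norm_deriv_le_segment_01' (C := ε * ‖h‖ * ‖h‖)
    (fun t _ => (hderiv t).hasDerivWithinAt)
    (fun t ht => (ContinuousLinearMap.le_opNorm _ _).trans
      (by gcongr; exact hfirst t (Set.Ico_subset_Icc_self ht)))
  convert this using 1
  · congr 1; simp; ring
  · ring

/-- Bounded weights do not destroy dominated convergence. -/
theorem tendsto_integral_bdd_mul_sub {α : Type*} [MeasurableSpace α] {μ : Measure α}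
    {w k : ℕ → α → ℝ} {k' bound : α → ℝ} {C : ℝ}
    (hw : ∀ n, Measurable (w n)) (hwC : ∀ n y, |w n y| ≤ C)
    (hk : ∀ n, AEStronglyMeasurable (k n) μ) (hk' : AEStronglyMeasurable k' μ)
    (hb : Integrable bound μ) (hkb : ∀ᶠ n in atTop, ∀ y, |k n y| ≤ bound y)
    (hlim : ∀ y, Tendsto (fun n => k n y) atTop (𝓝 (k' y))) :
    Tendsto (fun n => ∫ y, w n y * (k n y - k' y) ∂μ) atTop (𝓝 0) := by
  have hk'b : ∀ y, |k' y| ≤ bound y := fun y =>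
    le_of_tendsto (hlim y).abs (hkb.mono fun n hn => hn y)
  rw [← integral_zero α ℝ (μ := μ)]
  refine tendsto_integral_filter_of_dominated_convergence (fun y => C * (bound y + bound y))
    (.of_forall fun n => (hw n).aestronglyMeasurable.mul ((hk n).sub hk')) ?_
    ((hb.add hb).const_mul C) (.of_forall fun y => ?_)
  · filter_upwards [hkb] with n hn
    refine .of_forall fun y => ?_
    rw [norm_mul, Real.norm_eq_abs, Real.norm_eq_abs]
    have := (abs_nonneg _).trans (hwC n y)
    gcongr
    · exact hwC n y
    · exact (abs_sub _ _).trans (add_le_add (hn y) (hk'b y))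
  · have h0 : Tendsto (fun n => C * |k n y - k' y|) atTop (𝓝 0) := by
      simpa using ((hlim y).sub_const (k' y)).abs.const_mul C
    refine squeeze_zero_norm (fun n => ?_) h0
    rw [norm_mul, Real.norm_eq_abs, Real.norm_eq_abs]
    gcongr
    exact hwC n y

section

variable {d : ℕ}

/-- Translating the test function along `i` shifts the argument of the oscillating factor. -/
theorem integral_comp_mul_eval_mul_translate (f : ℝ → ℝ) {q g : (Fin d → ℝ) → ℝ} {i : Fin d}
    (hq : ∀ (y : Fin d → ℝ) (s : ℝ), q (y + s • Pi.single i 1) = q y)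
    {n : ℝ} (hn : n ≠ 0) (v : ℝ) :
    ∫ y, f (n * y i) * q y * g (y - (v / n) • Pi.single i 1)
      = ∫ y, f (n * y i + v) * q y * g y := by
  rw [← integral_add_right_eq_self _ ((v / n) • (Pi.single i 1 : Fin d → ℝ))]
  congr 1 with y
  rw [hq, add_sub_cancel_right]
  congr 3
  simp
  field_simp

section
variable {f : ℝ → ℝ} {q g : (Fin d → ℝ) → ℝ} {C : ℝ}

theorem integrable_prod_comp_mul_eval_mul (hf : Measurable f) (hfC : ∀ t, |f t| ≤ C)
    (hq : Measurable q) (hq1 : ∀ y, |q y| ≤ 1) (hg : Integrable g) (n : ℝ) (i : Fin d) :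
    Integrable (fun p : (Fin d → ℝ) × ℝ => f (n * p.1 i + p.2) * q p.1 * g p.1)
      (volume.prod (volume.restrict (Set.Ioc (0 : ℝ) 1))) := by
  refine Integrable.bdd_mul (c := C) (hg.comp_fst _) ?_ ?_
  · exact Measurable.aestronglyMeasurable (by fun_prop)
  · refine .of_forall fun p => ?_
    rw [norm_mul, Real.norm_eq_abs, Real.norm_eq_abs]
    have := (abs_nonneg _).trans (hfC 0)
    simpa using mul_le_mul (hfC (n * p.1 i + p.2)) (hq1 p.1) (abs_nonneg _) this

/-- Averaging over all shifts replaces a periodic factor by its mean. -/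
theorem integral_translate_average (hf : Measurable f) (hfC : ∀ t, |f t| ≤ C)
    (hper : Function.Periodic f 1) (hq : Measurable q)
    (hq1 : ∀ y, |q y| ≤ 1) (hg : Integrable g) (n : ℝ) (i : Fin d) :
    ∫ v in (0 : ℝ)..1, ∫ y, f (n * y i + v) * q y * g y
      = (∫ t in (0 : ℝ)..1, f t) * ∫ y, q y * g y := by
  have hswap := integrable_prod_comp_mul_eval_mul hf hfC hq hq1 hg n i
  rw [intervalIntegral.integral_of_le zero_le_one, ← integral_integral_swap hswap,
    ← integral_const_mul]
  congr 1 with y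
  rw [integral_mul_const, integral_mul_const, mul_assoc]
  congr 1
  rw [← intervalIntegral.integral_of_le zero_le_one,
    intervalIntegral.integral_comp_add_left f]
  simpa using hper.intervalIntegral_add_eq (n * y i) 0

theorem integrable_comp_mul_eval_mul (hf : Measurable f) (hfC : ∀ t, |f t| ≤ C)
    (hq : Measurable q) (hq1 : ∀ y, |q y| ≤ 1) (hg : Integrable g) (n : ℝ) (i : Fin d) (v : ℝ) :
    Integrable (fun y : Fin d → ℝ => f (n * y i + v) * q y * g y) := by
  refine Integrable.bdd_mul (c := C) hg (Measurable.aestronglyMeasurable (by fun_prop))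
    (.of_forall fun y => ?_)
  rw [norm_mul, Real.norm_eq_abs, Real.norm_eq_abs]
  have := (abs_nonneg _).trans (hfC 0)
  simpa using mul_le_mul (hfC (n * y i + v)) (hq1 y) (abs_nonneg _) this

end

theorem norm_single_one_smul_div_le {n : ℕ} (hn : 1 ≤ n) {v : ℝ} (hv : v ∈ Set.Ioc (0 : ℝ) 1)
    (i : Fin d) : ‖(v / (n : ℝ)) • (Pi.single i 1 : Fin d → ℝ)‖ ≤ v / n := by
  have hn' : (1 : ℝ) ≤ n := by exact_mod_cast hn
  rw [norm_smul, Pi.norm_single, norm_one, mul_one,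
    Real.norm_of_nonneg (by have := hv.1; positivity)]

/-- The deviation of an oscillating integral from its averaged value, rescaled by `a n`, tends to
zero as soon as the rescaled increments `a n * (g y - g (y - (v / n) eᵢ))` are bounded and converge
to functions `k v` against which the oscillating factor integrates to zero in the limit. -/
theorem tendsto_scaled_integral_periodic_mul {f : ℝ → ℝ} {q : ℕ → (Fin d → ℝ) → ℝ}
    {g : (Fin d → ℝ) → ℝ} {C B : ℝ} {i : Fin d} {a : ℕ → ℝ} {k : ℝ → (Fin d → ℝ) → ℝ}
    (hf : Measurable f) (hfC : ∀ t, |f t| ≤ C) (hper : Function.Periodic f 1)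
    (hq : ∀ n, Measurable (q n)) (hq1 : ∀ n y, |q n y| ≤ 1)
    (hqi : ∀ n (y : Fin d → ℝ) (s : ℝ), q n (y + s • Pi.single i 1) = q n y)
    (hg : Continuous g) (hgc : HasCompactSupport g)
    (hk : ∀ v, Continuous (k v)) (hkc : ∀ v, HasCompactSupport (k v))
    (hB : ∀ n : ℕ, 1 ≤ n → ∀ v ∈ Set.Ioc (0 : ℝ) 1, ∀ y,
      |a n * (g y - g (y - (v / n) • Pi.single i 1))| ≤ B)
    (hlim : ∀ v ∈ Set.Ioc (0 : ℝ) 1, ∀ y,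
      Tendsto (fun n : ℕ => a n * (g y - g (y - (v / n) • Pi.single i 1))) atTop (𝓝 (k v y)))
    (hkf : ∀ v ∈ Set.Ioc (0 : ℝ) 1,
      Tendsto (fun n : ℕ => ∫ y, f (n * y i) * q n y * k v y) atTop (𝓝 0)) :
    Tendsto (fun n : ℕ => a n * ((∫ y, f (n * y i) * q n y * g y)
      - (∫ t in (0 : ℝ)..1, f t) * ∫ y, q n y * g y)) atTop (𝓝 0) := by
  have hgi : Integrable g := hg.integrable_of_hasCompactSupport hgc
  have hC : 0 ≤ C := (abs_nonneg _).trans (hfC 0)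
  have hw : ∀ n : ℕ, Measurable fun y : Fin d → ℝ => f (n * y i) * q n y := fun n => by
    have := hq n
    fun_prop
  have hwC : ∀ (n : ℕ) (y : Fin d → ℝ), |f (n * y i) * q n y| ≤ C := fun n y => by
    rw [abs_mul]
    simpa using mul_le_mul (hfC (n * y i)) (hq1 n y) (abs_nonneg _) hC
  have hinner : ∀ n : ℕ, 1 ≤ n → ∀ v : ℝ,
      ∫ y, f (n * y i) * q n y * (a n * (g y - g (y - (v / n) • Pi.single i 1)))
        = a n * ((∫ y, f (n * y i) * q n y * g y) - ∫ y, f (n * y i + v) * q n y * g y) := by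
    intro n hn v
    have hn0 : (n : ℝ) ≠ 0 := by positivity
    have h1 := integrable_comp_mul_eval_mul hf hfC (hq n) (hq1 n) hgi n i 0
    have h2 := integrable_comp_mul_eval_mul hf hfC (hq n) (hq1 n)
      (hgi.comp_sub_right ((v / n) • Pi.single i 1)) n i 0
    simp only [add_zero] at h1 h2
    rw [← integral_comp_mul_eval_mul_translate f (hqi n) hn0, ← integral_sub h1 h2,
      ← integral_const_mul]
    congr 1 with y
    ring
  have hJ : ∀ n : ℕ, Integrable (fun v => ∫ y, f (n * y i + v) * q n y * g y)
      (volume.restrict (Set.Ioc (0 : ℝ) 1)) := fun n =>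
    (integrable_prod_comp_mul_eval_mul hf hfC (hq n) (hq1 n) hgi n i).integral_prod_right
  have hmain : Tendsto (fun n : ℕ => ∫ v in (0 : ℝ)..1,
      ∫ y, f (n * y i) * q n y * (a n * (g y - g (y - (v / n) • Pi.single i 1))))
      atTop (𝓝 (∫ v in (0 : ℝ)..1, (0 : ℝ))) := by
    set K := Metric.cthickening 1 (tsupport g) with hK
    have hKc : IsCompact K := IsCompact.cthickening hgc
    have hbi : Integrable (K.indicator fun _ => B) (volume : Measure (Fin d → ℝ)) :=
      (integrable_indicator_iff hKc.measurableSet).2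
        (integrableOn_const hKc.measure_lt_top.ne)
    have hbound : ∀ n : ℕ, 1 ≤ n → ∀ v ∈ Set.Ioc (0 : ℝ) 1, ∀ y,
        |a n * (g y - g (y - (v / n) • Pi.single i 1))| ≤ K.indicator (fun _ => B) y := by
      intro n hn v hv y
      by_cases hy : y ∈ K
      · rw [Set.indicator_of_mem hy]
        exact hB n hn v hv y
      · rw [Set.indicator_of_notMem hy]
        have h0 : g y = 0 := image_eq_zero_of_notMem_tsupport
          fun h => hy (Metric.self_subset_cthickening _ h)
        have h1 : g (y - (v / n) • Pi.single i 1) = 0 := by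
          refine image_eq_zero_of_notMem_tsupport fun h =>
            hy (Metric.mem_cthickening_of_dist_le _ _ _ _ h ?_)
          rw [dist_eq_norm, sub_sub_cancel]
          refine (norm_single_one_smul_div_le hn hv i).trans ?_
          have hn' : (1 : ℝ) ≤ n := by exact_mod_cast hn
          exact (div_le_self hv.1.le hn').trans hv.2
        simp [h0, h1]
    refine intervalIntegral.tendsto_integral_filter_of_dominated_convergence
      (fun _ => ∫ y, C * K.indicator (fun _ => B) y) ?_ ?_ (by simp) ?_
    · filter_upwards [eventually_ge_atTop 1] with n hn
      simp_rw [hinner n hn, Set.uIoc_of_le (zero_le_one' ℝ)]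
      exact (((integrable_const _).sub (hJ n)).const_mul _).aestronglyMeasurable
    · filter_upwards [eventually_ge_atTop 1] with n hn
      refine .of_forall fun v hv => ?_
      rw [Set.uIoc_of_le zero_le_one] at hv
      refine norm_integral_le_of_norm_le (hbi.const_mul C) (.of_forall fun y => ?_)
      rw [norm_mul]
      exact mul_le_mul (hwC n y) (hbound n hn v hv y) (norm_nonneg _) hC
    · refine .of_forall fun v hv => ?_
      rw [Set.uIoc_of_le zero_le_one] at hv
      have hdom := tendsto_integral_bdd_mul_sub (μ := volume) hw hwC
        (k := fun n y => a n * (g y - g (y - (v / n) • Pi.single i 1))) (k' := k v)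
        (fun n => Continuous.aestronglyMeasurable (by fun_prop)) (hk v).aestronglyMeasurable
        hbi ((eventually_ge_atTop 1).mono fun n hn => hbound n hn v hv) (hlim v hv)
      have hsum := hdom.add (hkf v hv)
      rw [add_zero] at hsum
      refine hsum.congr fun n => ?_
      have hki : Integrable fun y => f (n * y i) * q n y * k v y :=
        ((hk v).integrable_of_hasCompactSupport (hkc v)).bdd_mul
          (hw n).aestronglyMeasurable (.of_forall (hwC n))
      have hgi' : Integrable fun y =>
          f (n * y i) * q n y * (a n * (g y - g (y - (v / n) • Pi.single i 1))) :=
        ((hgi.sub (hgi.comp_sub_right ((v / (n : ℝ)) • Pi.single i 1))).const_mul (a n)).bdd_mul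
          (hw n).aestronglyMeasurable (.of_forall (hwC n))
      simp_rw [mul_sub (f _ * q _ _) (a _ * _)]
      rw [integral_sub hgi' hki, sub_add_cancel]
  rw [intervalIntegral.integral_zero] at hmain
  refine hmain.congr' ?_
  filter_upwards [eventually_ge_atTop 1] with n hn
  simp_rw [hinner n hn]
  rw [intervalIntegral.integral_const_mul, intervalIntegral.integral_sub (by simp)
    ((intervalIntegrable_iff_integrableOn_Ioc_of_le zero_le_one).2 (hJ n)),
    integral_translate_average hf hfC hper (hq n) (hq1 n) hgi]
  simp

/-- Weak convergence of a rapidly oscillating periodic factor to its mean. -/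
theorem tendsto_integral_periodic_mul {f : ℝ → ℝ} {q : ℕ → (Fin d → ℝ) → ℝ}
    {g : (Fin d → ℝ) → ℝ} {C : ℝ} {i : Fin d}
    (hf : Measurable f) (hfC : ∀ t, |f t| ≤ C) (hper : Function.Periodic f 1)
    (hq : ∀ n, Measurable (q n)) (hq1 : ∀ n y, |q n y| ≤ 1)
    (hqi : ∀ n (y : Fin d → ℝ) (s : ℝ), q n (y + s • Pi.single i 1) = q n y)
    (hg : Continuous g) (hgc : HasCompactSupport g) :
    Tendsto (fun n : ℕ => (∫ y, f (n * y i) * q n y * g y)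
      - (∫ t in (0 : ℝ)..1, f t) * ∫ y, q n y * g y) atTop (𝓝 0) := by
  obtain ⟨B, hB⟩ := hgc.exists_bound_of_continuous hg
  have := tendsto_scaled_integral_periodic_mul (a := fun _ => 1) (k := fun _ _ => 0)
    (B := B + B) hf hfC hper hq hq1 hqi hg hgc (fun _ => continuous_const)
    (fun _ => HasCompactSupport.zero)
    (fun n _ v _ y => by
      rw [one_mul]
      exact (abs_sub _ _).trans (add_le_add (hB _) (hB _)))
    (fun v _ y => by
      have h1 : Tendsto (fun n : ℕ => y - (v / (n : ℝ)) • (Pi.single i 1 : Fin d → ℝ)) atTop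
          (𝓝 (y - (0 : ℝ) • Pi.single i 1)) :=
        ((tendsto_const_div_atTop_nhds_zero_nat v).smul_const _).const_sub y
      have h2 := (hg.tendsto _).comp h1
      simpa using (h2.const_sub (g y)))
    (fun v _ => by simp)
  simpa using this

/-- Against `C¹` functions, a mean-zero oscillating factor integrates to `o(1 / n)`. -/
theorem tendsto_nat_mul_integral_periodic_mul {f : ℝ → ℝ} {g : (Fin d → ℝ) → ℝ} {C : ℝ}
    (hf : Measurable f) (hfC : ∀ t, |f t| ≤ C) (hper : Function.Periodic f 1)
    (hmean : ∫ t in (0 : ℝ)..1, f t = 0)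
    (hg : ContDiff ℝ 1 g) (hgc : HasCompactSupport g) (i : Fin d) :
    Tendsto (fun n : ℕ => (n : ℝ) * ∫ y, f (n * y i) * g y) atTop (𝓝 0) := by
  obtain ⟨L, hL⟩ := ContDiff.lipschitzWith_of_hasCompactSupport hgc hg (by norm_num)
  have hgd : Differentiable ℝ g := hg.differentiable (by norm_num)
  have hD : Continuous fun y => fderiv ℝ g y (Pi.single i 1) :=
    (hg.continuous_fderiv (by norm_num)).clm_apply continuous_const
  have hDc : HasCompactSupport fun y => fderiv ℝ g y (Pi.single i 1) :=
    hgc.fderiv_apply ℝ _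
  have := tendsto_scaled_integral_periodic_mul (a := fun n => (n : ℝ)) (i := i)
    (k := fun v y => v * fderiv ℝ g y (Pi.single i 1)) (q := fun _ _ => 1) (B := L)
    hf hfC hper (fun _ => measurable_const) (fun _ _ => by simp) (fun _ _ _ => rfl)
    hg.continuous hgc (fun v => continuous_const.mul hD)
    (fun v => hDc.mul_left)
    (fun n hn v hv y => by
      have hn' : (0 : ℝ) < n := by exact_mod_cast hn
      have h1 := hL.dist_le_mul y (y - (v / (n : ℝ)) • Pi.single i 1)
      rw [dist_eq_norm, dist_eq_norm, sub_sub_cancel] at h1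
      rw [abs_mul, abs_of_pos hn']
      calc (n : ℝ) * |g y - g (y - (v / (n : ℝ)) • Pi.single i 1)|
          ≤ n * (L * (v / n)) := by
            gcongr
            exact h1.trans (by gcongr; exact norm_single_one_smul_div_le hn hv i)
        _ = L * v := by field_simp
        _ ≤ L := mul_le_of_le_one_right L.2 hv.2)
    (fun v hv y => by
      have h1 := ((hgd y).hasFDerivAt.lim (-(v • (Pi.single i 1 : Fin d → ℝ)))
        (c := fun n : ℕ => (n : ℝ)) (l := atTop)
        (by simpa using tendsto_natCast_atTop_atTop)).neg
      simp only [map_neg, map_smul, smul_eq_mul, neg_neg, smul_neg, smul_smul] at h1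
      refine h1.congr fun n => ?_
      rw [← sub_eq_add_neg, inv_mul_eq_div]
      ring)
    (fun v _ => by
      have := tendsto_integral_periodic_mul (q := fun _ _ => 1) (i := i) hf hfC hper
        (fun _ => measurable_const)
        (fun _ _ => by simp) (fun _ _ _ => rfl) (continuous_const.mul hD)
        (hDc.mul_left (f := fun _ => v))
      simpa [hmean] using this)
  simpa [hmean] using this

theorem abs_half_sub_fract_le (t : ℝ) : |1 / 2 - Int.fract t| ≤ 1 / 2 := by
  rw [abs_le]
  constructor <;> linarith [Int.fract_nonneg t, Int.fract_lt_one t]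

theorem measurable_half_sub_fract : Measurable fun t : ℝ => 1 / 2 - Int.fract t :=
  measurable_const.sub measurable_fract

theorem periodic_half_sub_fract : Function.Periodic (fun t : ℝ => 1 / 2 - Int.fract t) 1 :=
  fun t => by simp

theorem integral_half_sub_fract_pow (p : ℕ) :
    ∫ t in (0 : ℝ)..1, (1 / 2 - Int.fract t) ^ p = ∫ t in (0 : ℝ)..1, (1 / 2 - t) ^ p :=
  intervalIntegral.integral_congr_Ioo_of_le zero_le_one fun t ht => by
    simp only [Int.fract_eq_self.2 ⟨ht.1.le, ht.2⟩]

theorem integral_half_sub_fract : ∫ t in (0 : ℝ)..1, (1 / 2 - Int.fract t) = 0 := by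
  have := integral_half_sub_fract_pow 1
  simp only [pow_one] at this
  rw [this, intervalIntegral.integral_sub (by simp) (by simp)]
  simp

theorem integral_half_sub_fract_sq : ∫ t in (0 : ℝ)..1, (1 / 2 - Int.fract t) ^ 2 = 1 / 12 := by
  rw [integral_half_sub_fract_pow,
    intervalIntegral.integral_comp_sub_left (fun t => t ^ 2) (1 / 2 : ℝ), integral_pow]
  norm_num

theorem norm_roundTheta_le (y : Fin d → ℝ) : ‖roundTheta y‖ ≤ 1 :=
  (pi_norm_le_iff_of_nonneg zero_le_one).2 fun i =>
    (abs_half_sub_fract_le (y i)).trans (by norm_num)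

theorem measurable_roundTheta : Measurable (roundTheta (d := d)) :=
  measurable_pi_lambda _ fun i => measurable_half_sub_fract.comp (measurable_pi_apply i)

theorem tendsto_integral_roundTheta_mul_roundTheta_mul {g : (Fin d → ℝ) → ℝ}
    (hg : Continuous g) (hgc : HasCompactSupport g) (i j : Fin d) :
    Tendsto (fun n : ℕ => ∫ y, roundTheta ((n : ℝ) • y) i * roundTheta ((n : ℝ) • y) j * g y)
      atTop (𝓝 (if i = j then (1 / 12) * ∫ y, g y else 0)) := by
  simp only [roundTheta, Pi.smul_apply, smul_eq_mul]
  split_ifs with hij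
  · subst hij
    have := tendsto_integral_periodic_mul (f := fun t => (1 / 2 - Int.fract t) ^ 2) (C := 1)
      (q := fun _ _ => 1) (i := i) (measurable_half_sub_fract.pow_const 2)
      (fun t => by
        rw [abs_pow]
        exact pow_le_one₀ (abs_nonneg _) ((abs_half_sub_fract_le t).trans (by norm_num)))
      (fun t => by simp) (fun _ => measurable_const) (fun _ _ => by simp) (fun _ _ _ => rfl)
      hg hgc
    simp only [integral_half_sub_fract_sq, mul_one, one_mul] at this
    simpa [sq] using this.add_const ((1 / 12) * ∫ y, g y)
  · have := tendsto_integral_periodic_mul (f := fun t => 1 / 2 - Int.fract t)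
      (q := fun n y => 1 / 2 - Int.fract ((n : ℝ) * y j)) (i := i) measurable_half_sub_fract
      abs_half_sub_fract_le periodic_half_sub_fract
      (fun n => measurable_half_sub_fract.comp (by fun_prop))
      (fun n y => (abs_half_sub_fract_le _).trans (by norm_num))
      (fun n y s => by simp [Pi.single_eq_of_ne (Ne.symm hij)]) hg hgc
    simpa only [integral_half_sub_fract, zero_mul, sub_zero] using this

theorem tendsto_nat_mul_integral_roundTheta_mul {g : (Fin d → ℝ) → ℝ}
    (hg : ContDiff ℝ 1 g) (hgc : HasCompactSupport g) (i : Fin d) :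
    Tendsto (fun n : ℕ => (n : ℝ) * ∫ y, roundTheta ((n : ℝ) • y) i * g y) atTop (𝓝 0) :=
  tendsto_nat_mul_integral_periodic_mul measurable_half_sub_fract abs_half_sub_fract_le
    periodic_half_sub_fract integral_half_sub_fract hg hgc i

end

/-- For `φ` of class `C²`, the functions
`y ↦ n²(φ(y + θ(ny)/n) − φ(y))` converge in the sense of distributions (against
smooth compactly supported test functions, w.r.t. Lebesgue measure) to `(1/24)Δφ`. -/
theorem stmt7 {d : ℕ} (φ : (Fin d → ℝ) → ℝ) (hφ : ContDiff ℝ 2 φ) :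
    ∀ χ : (Fin d → ℝ) → ℝ, ContDiff ℝ (⊤ : ℕ∞) χ → HasCompactSupport χ →
      Tendsto (fun n : ℕ =>
          ∫ y, (n:ℝ)^2 * (φ (y + (1 / (n:ℝ)) • roundTheta ((n:ℝ) • y)) - φ y) * χ y)
        atTop
        (nhds ((1 / 24) *
          ∫ y, (∑ i, fderiv ℝ (fun z => fderiv ℝ φ z (Pi.single i 1)) y (Pi.single i 1))
            * χ y)) := by
  intro χ hχ hχc
  have hD : ContDiff ℝ 1 (fderiv ℝ φ) := hφ.fderiv_right (by norm_num)
  have hDd : Differentiable ℝ (fderiv ℝ φ) := hD.differentiable (by norm_num)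
  have hDD : Continuous (fderiv ℝ (fderiv ℝ φ)) := hD.continuous_fderiv (by norm_num)
  have hχi : Integrable χ := hχ.continuous.integrable_of_hasCompactSupport hχc
  set e : Fin d → Fin d → ℝ := fun i => Pi.single i 1 with he
  set g₁ : Fin d → (Fin d → ℝ) → ℝ := fun i y => fderiv ℝ φ y (e i) * χ y with hg₁
  set g₂ : Fin d → Fin d → (Fin d → ℝ) → ℝ :=
    fun i j y => fderiv ℝ (fderiv ℝ φ) y (e i) (e j) * χ y with hg₂
  have hg₁C : ∀ i, ContDiff ℝ 1 (g₁ i) := fun i =>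
    (hD.clm_apply contDiff_const).mul (hχ.of_le (by exact_mod_cast le_top))
  have hg₁c : ∀ i, HasCompactSupport (g₁ i) := fun i => hχc.mul_left
  have hg₂C : ∀ i j, Continuous (g₂ i j) := fun i j =>
    ((hDD.clm_apply continuous_const).clm_apply continuous_const).mul hχ.continuous
  have hg₂c : ∀ i j, HasCompactSupport (g₂ i j) := fun i j => hχc.mul_left
  set T : ℕ → (Fin d → ℝ) → Fin d → ℝ := fun n y => roundTheta ((n : ℝ) • y) with hT
  have hTm : ∀ n, Measurable (T n) := fun n => measurable_roundTheta.comp (by fun_prop)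
  have hTi : ∀ n i, Measurable fun y => T n y i := fun n i => (measurable_pi_apply i).comp (hTm n)
  have hT1 : ∀ n y, ‖T n y‖ ≤ 1 := fun n y => norm_roundTheta_le _
  have hTi1 : ∀ n y i, ‖T n y i‖ ≤ 1 := fun n y i => (norm_le_pi_norm _ i).trans (hT1 n y)
  have hI₁ : ∀ n i, Integrable fun y => T n y i * g₁ i y := fun n i =>
    ((hg₁C i).continuous.integrable_of_hasCompactSupport (hg₁c i)).bdd_mul
      (hTi n i).aestronglyMeasurable (.of_forall fun y => hTi1 n y i)
  have hI₂ : ∀ n i j, Integrable fun y => T n y i * T n y j * g₂ i j y := fun n i j =>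
    ((hg₂C i j).integrable_of_hasCompactSupport (hg₂c i j)).bdd_mul (c := 1)
      ((hTi n i).mul (hTi n j)).aestronglyMeasurable (.of_forall fun y => by
        rw [norm_mul]
        exact mul_le_one₀ (hTi1 n y i) (norm_nonneg _) (hTi1 n y j))
  -- the second-order Taylor polynomial of the integrand
  set P : ℕ → (Fin d → ℝ) → ℝ := fun n y =>
    n * ∑ i, T n y i * g₁ i y + 1 / 2 * ∑ i, ∑ j, T n y i * T n y j * g₂ i j y with hP
  set A : ℕ → (Fin d → ℝ) → ℝ := fun n y =>
    (n : ℝ) ^ 2 * (φ (y + (1 / (n : ℝ)) • T n y) - φ y) * χ y with hA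
  have hS₁ : ∀ n : ℕ, Integrable fun y => (n : ℝ) * ∑ i, T n y i * g₁ i y := fun n =>
    (integrable_finsetSum _ fun i _ => hI₁ n i).const_mul _
  have hS₂ : ∀ n : ℕ, Integrable fun y =>
      1 / 2 * ∑ i, ∑ j, T n y i * T n y j * g₂ i j y := fun n =>
    (integrable_finsetSum _ fun i _ => integrable_finsetSum _ fun j _ => hI₂ n i j).const_mul _
  have hPi : ∀ n, Integrable (P n) := fun n => (hS₁ n).add (hS₂ n)
  have hAm : ∀ n, Measurable (A n) := fun n => by
    have := hTm n
    have h1 : Measurable fun y => φ (y + (1 / (n : ℝ)) • T n y) :=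
      hφ.continuous.measurable.comp (by fun_prop)
    exact ((h1.sub hφ.continuous.measurable).const_mul _).mul hχ.continuous.measurable
  have hPeq : ∀ n y, P n y = (n * fderiv ℝ φ y (T n y)
      + 1 / 2 * fderiv ℝ (fderiv ℝ φ) y (T n y) (T n y)) * χ y := by
    intro n y
    have hsum : T n y = ∑ i, T n y i • e i := by
      simpa [he] using (pi_eq_sum_univ' (T n y))
    have h1 : fderiv ℝ φ y (T n y) = ∑ i, T n y i * fderiv ℝ φ y (e i) := by
      conv_lhs => rw [hsum]
      simp
    have h2 : fderiv ℝ (fderiv ℝ φ) y (T n y) (T n y)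
        = ∑ i, ∑ j, T n y i * T n y j * fderiv ℝ (fderiv ℝ φ) y (e i) (e j) := by
      conv_lhs => rw [hsum]
      simp only [map_sum, map_smul, sum_apply, smul_apply, smul_eq_mul, Finset.mul_sum]
      rw [Finset.sum_comm]
      exact Finset.sum_congr rfl fun i _ => Finset.sum_congr rfl fun j _ => by ring
    simp only [hP, hg₁, hg₂, h1, h2, add_mul, mul_assoc, Finset.sum_mul]
  have hrem : ∀ ε > 0, ∀ᶠ n : ℕ in atTop, ∀ y, ‖A n y - P n y‖ ≤ ε * ‖χ y‖ := by
    intro ε hε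
    obtain ⟨δ, hδ, H⟩ := exists_forall_norm_sub_taylor_two_le hφ hχc.isCompact hε
    filter_upwards [eventually_ge_atTop 1,
      (tendsto_one_div_atTop_nhds_zero_nat (𝕜 := ℝ)).eventually_lt_const hδ] with n hn hnδ y
    have hn' : (0 : ℝ) < n := by exact_mod_cast hn
    by_cases hy : y ∈ tsupport χ
    · have hnorm : ‖(1 / (n : ℝ)) • T n y‖ ≤ 1 / n := by
        rw [norm_smul, Real.norm_of_nonneg (by positivity)]
        exact mul_le_of_le_one_right (by positivity) (hT1 n y)
      have h1 := H y hy _ (hnorm.trans_lt hnδ)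
      have h2 : A n y - P n y = (n : ℝ) ^ 2 * (φ (y + (1 / (n : ℝ)) • T n y) - φ y
          - fderiv ℝ φ y ((1 / (n : ℝ)) • T n y)
          - 1 / 2 * fderiv ℝ (fderiv ℝ φ) y ((1 / (n : ℝ)) • T n y) ((1 / (n : ℝ)) • T n y))
          * χ y := by
        rw [hPeq, hA]
        simp only [map_smul, smul_apply, smul_eq_mul]
        field_simp
        ring
      rw [h2, norm_mul, norm_mul, Real.norm_of_nonneg (by positivity)]
      gcongr
      calc _ ≤ (n : ℝ) ^ 2 * (ε * (1 / n) ^ 2) := by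
            gcongr
            exact h1.trans (by gcongr)
        _ = ε := by field_simp
    · have h0 : χ y = 0 := image_eq_zero_of_notMem_tsupport hy
      simp [hA, hPeq, h0]
  have hR : Tendsto (fun n => ∫ y, (A n y - P n y)) atTop (𝓝 0) := by
    rw [Metric.tendsto_nhds]
    intro ε hε
    have hpos : 0 < (∫ y, ‖χ y‖) + 1 := by positivity
    filter_upwards [hrem (ε / ((∫ y, ‖χ y‖) + 1)) (by positivity)] with n hn
    rw [dist_zero_right]
    refine (norm_integral_le_of_norm_le (hχi.norm.const_mul _) (.of_forall hn)).trans_lt ?_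
    rw [integral_const_mul, div_mul_eq_mul_div, div_lt_iff₀ hpos]
    nlinarith
  have hlim : Tendsto (fun n => ∫ y, P n y) atTop
      (𝓝 (∑ _i : Fin d, (0 : ℝ)
        + 1 / 2 * ∑ i, ∑ j, if i = j then 1 / 12 * ∫ y, g₂ i j y else 0)) := by
    have h := (tendsto_finsetSum Finset.univ fun i _ =>
      tendsto_nat_mul_integral_roundTheta_mul (hg₁C i) (hg₁c i) i).add
      ((tendsto_finsetSum Finset.univ fun i _ => tendsto_finsetSum Finset.univ fun j _ =>
        tendsto_integral_roundTheta_mul_roundTheta_mul (hg₂C i j) (hg₂c i j) i j).const_mul (1 / 2))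
    refine h.congr fun n => ?_
    rw [integral_add (hS₁ n) (hS₂ n), integral_const_mul, integral_const_mul,
      integral_finsetSum _ fun i _ => hI₁ n i,
      integral_finsetSum _ fun i _ => integrable_finsetSum _ fun j _ => hI₂ n i j,
      Finset.mul_sum Finset.univ fun i => ∫ y, T n y i * g₁ i y]
    simp_rw [integral_finsetSum _ fun j _ => hI₂ n _ j]
    rfl
  have hlap : ∀ y, (∑ i, fderiv ℝ (fun z => fderiv ℝ φ z (e i)) y (e i)) * χ y
      = ∑ i, g₂ i i y := by
    intro y
    rw [Finset.sum_mul]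
    refine Finset.sum_congr rfl fun i _ => ?_
    rw [fderiv_clm_apply (hDd y) (differentiableAt_const _)]
    simp [hg₂]
  have hval : 1 / 24 * ∫ y, (∑ i, fderiv ℝ (fun z => fderiv ℝ φ z (e i)) y (e i)) * χ y
      = 0 + (∑ _i : Fin d, (0 : ℝ)
        + 1 / 2 * ∑ i, ∑ j, if i = j then 1 / 12 * ∫ y, g₂ i j y else 0) := by
    simp_rw [hlap]
    rw [integral_finsetSum _ fun i _ =>
      (hg₂C i i).integrable_of_hasCompactSupport (hg₂c i i)]
    simp [← Finset.mul_sum]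
    ring
  rw [hval]
  refine (hR.add hlim).congr' ?_
  filter_upwards [hrem 1 one_pos] with n hn
  have hAP : Integrable fun y => A n y - P n y :=
    (hχi.norm.const_mul 1).mono' ((hAm n).aestronglyMeasurable.sub (hPi n).1) (.of_forall hn)
  rw [← integral_add hAP (hPi n)]
  simp only [sub_add_cancel, hA, hT]
end

section
/- Let μ be a finite Rajchman measure on [0,1] and f a bounded Riemann-integrable 1-periodic function with ∫₀¹ f(s) ds = 0. Then sup_{0 ≤ t ≤ 1} |∫₀ᵗ f(ns) dμ(s)| → 0 as n → ∞. -/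
open MeasureTheory Filter

/-- A family is infinitesimal if it is a uniform limit of infinitesimal families. -/
lemma tendsto_zero_of_forall_exists_norm_sub_le {ι E : Type*} [SeminormedAddCommGroup E]
    {l : Filter ι} {u : ι → E}
    (h : ∀ ε > 0, ∃ v : ι → E, Tendsto v l (nhds 0) ∧ ∀ i, ‖u i - v i‖ ≤ ε) :
    Tendsto u l (nhds 0) := by
  rw [NormedAddGroup.tendsto_nhds_zero]
  intro ε hε
  obtain ⟨v, hv, huv⟩ := h (ε / 2) (half_pos hε)
  filter_upwards [NormedAddGroup.tendsto_nhds_zero.1 hv (ε / 2) (half_pos hε)] with i hi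
  have := norm_add_le (u i - v i) (v i)
  rw [sub_add_cancel] at this
  linarith [huv i]

/-- A property of continuous functions on the circle which is linear, holds for the Fourier
monomials and is stable under uniform approximation holds for all continuous functions. -/
lemma ContinuousMap.induction_on_fourier {T : ℝ} [Fact (0 < T)] {p : C(AddCircle T, ℂ) → Prop}
    (fourier : ∀ n, p (fourier n)) (zero : p 0) (add : ∀ f g, p f → p g → p (f + g))
    (smul : ∀ (c : ℂ) f, p f → p (c • f))
    (approx : ∀ f, (∀ ε > 0, ∃ g, p g ∧ ‖f - g‖ < ε) → p f) (f : C(AddCircle T, ℂ)) : p f := by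
  refine approx f fun ε hε => ?_
  have hf : f ∈ (Submodule.span ℂ (Set.range (@_root_.fourier T))).topologicalClosure := by
    rw [span_fourier_closure_eq_top]; trivial
  obtain ⟨g, hg, hfg⟩ := Metric.mem_closure_iff.1 hf ε hε
  refine ⟨g, ?_, by rwa [← dist_eq_norm]⟩
  refine Submodule.span_induction (p := fun g _ => p g) ?_ zero
    (fun f g _ _ => add f g) (fun c f _ => smul c f) hg
  rintro _ ⟨n, rfl⟩
  exact fourier n

lemma norm_fourier_apply {T : ℝ} (n : ℤ) (x : AddCircle T) : ‖fourier n x‖ = 1 := by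
  rw [fourier_apply, Circle.norm_coe]

lemma ContinuousMap.integrable_of_compactSpace {X E : Type*} [TopologicalSpace X] [CompactSpace X]
    [MeasurableSpace X] [OpensMeasurableSpace X] [NormedAddCommGroup E]
    [SecondCountableTopologyEither X E] (g : C(X, E)) (ν : Measure X) [IsFiniteMeasure ν] :
    Integrable g ν :=
  .of_bound g.continuous.aestronglyMeasurable ‖g‖ (.of_forall g.norm_coe_le_norm)

section Circle

variable {T : ℝ} [Fact (0 < T)] {ν ρ : Measure (AddCircle T)} [IsFiniteMeasure ν]
  [IsFiniteMeasure ρ]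

lemma tendsto_integral_continuousMap_mul_fourier
    (hν : Tendsto (fun n : ℤ => ∫ x, fourier n x ∂ν) cofinite (nhds 0)) (g : C(AddCircle T, ℂ)) :
    Tendsto (fun n : ℤ => ∫ x, g x * fourier n x ∂ν) cofinite (nhds 0) := by
  have hint (g : C(AddCircle T, ℂ)) (n : ℤ) : Integrable (fun x => g x * fourier n x) ν :=
    (g * fourier n).integrable_of_compactSpace ν
  induction g using ContinuousMap.induction_on_fourier with
  | fourier k =>
    simp_rw [← fourier_add]
    exact hν.comp (add_right_injective k).tendsto_cofinite
  | zero => simp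
  | add f g hf hg =>
    simp_rw [ContinuousMap.add_apply, add_mul, integral_add (hint _ _) (hint _ _)]
    simpa using hf.add hg
  | smul c f hf =>
    simp_rw [ContinuousMap.smul_apply, smul_eq_mul, mul_assoc, integral_const_mul]
    simpa using hf.const_mul c
  | approx f hf =>
    refine tendsto_zero_of_forall_exists_norm_sub_le fun ε hε => ?_
    have hM : 0 < ν.real Set.univ + 1 := by positivity
    obtain ⟨g, hg, hfg⟩ := hf (ε / (ν.real Set.univ + 1)) (by positivity)
    refine ⟨_, hg, fun n => ?_⟩
    rw [← integral_sub (hint _ _) (hint _ _)]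
    calc _ ≤ ‖f - g‖ * ν.real Set.univ := by
          refine norm_integral_le_of_norm_le_const (.of_forall fun x => ?_)
          rw [← sub_mul, norm_mul, norm_fourier_apply, mul_one]
          exact (f - g).norm_coe_le_norm x
      _ ≤ ε / (ν.real Set.univ + 1) * (ν.real Set.univ + 1) := by gcongr; linarith
      _ = ε := by field_simp

lemma tendsto_integral_mul_fourier
    (hν : Tendsto (fun n : ℤ => ∫ x, fourier n x ∂ν) cofinite (nhds 0)) {h : AddCircle T → ℂ}
    (hh : Integrable h ν) :
    Tendsto (fun n : ℤ => ∫ x, h x * fourier n x ∂ν) cofinite (nhds 0) := by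
  have hint {h : AddCircle T → ℂ} (hh : Integrable h ν) (n : ℤ) :
      Integrable (fun x => h x * fourier n x) ν :=
    hh.mul_bdd (c := 1) (fourier n).continuous.aestronglyMeasurable
      (.of_forall fun x => (norm_fourier_apply n x).le)
  refine tendsto_zero_of_forall_exists_norm_sub_le fun ε hε => ?_
  obtain ⟨g, hg, hgi⟩ := hh.exists_boundedContinuous_integral_sub_le hε
  refine ⟨_, tendsto_integral_continuousMap_mul_fourier hν g.toContinuousMap, fun n => ?_⟩
  change ‖(∫ x, h x * fourier n x ∂ν) - ∫ x, g x * fourier n x ∂ν‖ ≤ ε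
  rw [← integral_sub (hint hh n) (hint hgi n)]
  refine (norm_integral_le_integral_norm _).trans (le_trans (le_of_eq ?_) hg)
  congr with x
  rw [← sub_mul, norm_mul, norm_fourier_apply, mul_one]

/-- A finite measure absolutely continuous with respect to a Rajchman measure is Rajchman. -/
lemma tendsto_integral_fourier_of_absolutelyContinuous (hρ : ρ ≪ ν)
    (hν : Tendsto (fun n : ℤ => ∫ x, fourier n x ∂ν) cofinite (nhds 0)) :
    Tendsto (fun n : ℤ => ∫ x, fourier n x ∂ρ) cofinite (nhds 0) := by
  refine (tendsto_integral_mul_fourier hν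
    (Measure.integrable_toReal_rnDeriv (μ := ρ) (ν := ν)).ofReal).congr fun n => ?_
  have : ρ.HaveLebesgueDecomposition ν := Measure.haveLebesgueDecomposition_of_sigmaFinite ρ ν
  exact integral_rnDeriv_smul hρ

/-- A Rajchman measure has no atoms. -/
lemma measure_singleton_eq_zero_of_tendsto_integral_fourier
    (hν : Tendsto (fun n : ℤ => ∫ x, fourier n x ∂ν) cofinite (nhds 0)) (x : AddCircle T) :
    ν {x} = 0 := by
  have h := (tendsto_integral_fourier_of_absolutelyContinuous
    (Measure.restrict_le_self (μ := ν) (s := {x})).absolutelyContinuous hν).norm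
  simp only [Measure.restrict_singleton, integral_smul_measure, integral_dirac, norm_smul,
    norm_fourier_apply, norm_zero, mul_one] at h
  have := tendsto_nhds_unique tendsto_const_nhds h
  simpa [ENNReal.toReal_eq_zero_iff] using this

/-- The images of a Rajchman measure under `x ↦ n • x` equidistribute. -/
lemma tendsto_integral_continuousMap_nsmul
    (hν : Tendsto (fun n : ℤ => ∫ x, fourier n x ∂ν) cofinite (nhds 0)) (g : C(AddCircle T, ℂ)) :
    Tendsto (fun n : ℕ => ∫ x, g (n • x) ∂ν) atTop
      (nhds (ν.real Set.univ * ∫ x, g x ∂AddCircle.haarAddCircle)) := by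
  have hint (g : C(AddCircle T, ℂ)) (n : ℕ) : Integrable (fun x => g (n • x)) ν :=
    (g.comp ⟨fun x => n • x, by fun_prop⟩).integrable_of_compactSpace ν
  have hint' (g : C(AddCircle T, ℂ)) : Integrable g AddCircle.haarAddCircle :=
    g.integrable_of_compactSpace _
  induction g using ContinuousMap.induction_on_fourier with
  | fourier k =>
    have hk := congrFun (fourierCoeff_fourier (T := T) k) 0
    simp only [fourierCoeff, neg_zero, fourier_zero, one_smul] at hk
    rw [hk]
    rcases eq_or_ne k 0 with rfl | hk0
    · simp
    · have hinj : Function.Injective fun n : ℕ => k * (n : ℤ) := fun a b hab => by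
        simpa [hk0] using hab
      have := hν.comp hinj.tendsto_cofinite
      rw [Nat.cofinite_eq_atTop] at this
      simpa [Pi.single_eq_of_ne hk0.symm, fourier_apply, Function.comp_def, mul_smul] using this
  | zero => simp
  | add f g hf hg =>
    simp_rw [ContinuousMap.add_apply, integral_add (hint _ _) (hint _ _),
      integral_add (hint' _) (hint' _), mul_add]
    exact hf.add hg
  | smul c f hf =>
    simp_rw [ContinuousMap.smul_apply, smul_eq_mul, integral_const_mul, mul_left_comm _ c]
    exact hf.const_mul c
  | approx f hf =>
    rw [← tendsto_sub_nhds_zero_iff]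
    refine tendsto_zero_of_forall_exists_norm_sub_le fun ε hε => ?_
    have hM : 0 < 2 * ν.real Set.univ + 1 := by positivity
    obtain ⟨g, hg, hfg⟩ := hf (ε / (2 * ν.real Set.univ + 1)) (by positivity)
    refine ⟨_, tendsto_sub_nhds_zero_iff.2 hg, fun n => ?_⟩
    rw [sub_sub_sub_comm, ← mul_sub, ← integral_sub (hint _ _) (hint _ _),
      ← integral_sub (hint' _) (hint' _)]
    have h₁ : ‖∫ x, f (n • x) - g (n • x) ∂ν‖ ≤ ‖f - g‖ * ν.real Set.univ :=
      norm_integral_le_of_norm_le_const (.of_forall fun x => (f - g).norm_coe_le_norm (n • x))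
    have h₂ : ‖∫ x, f x - g x ∂AddCircle.haarAddCircle‖ ≤ ‖f - g‖ := by
      simpa using norm_integral_le_of_norm_le_const (μ := AddCircle.haarAddCircle)
        (.of_forall fun x => (f - g).norm_coe_le_norm x)
    calc _ ≤ ‖f - g‖ * ν.real Set.univ + ν.real Set.univ * ‖f - g‖ := by
          refine (norm_sub_le _ _).trans (add_le_add h₁ ?_)
          rw [norm_mul, Complex.norm_real, Real.norm_of_nonneg measureReal_nonneg]
          gcongr
      _ = ‖f - g‖ * (2 * ν.real Set.univ) := by ring
      _ ≤ ε / (2 * ν.real Set.univ + 1) * (2 * ν.real Set.univ + 1) := by gcongr; linarith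
      _ = ε := by field_simp

end Circle

section Line

lemma integral_map_coe_addCircle {ρ : Measure ℝ} {T : ℝ} {E : Type*} [NormedAddCommGroup E] [NormedSpace ℝ E]
    (g : AddCircle T → E) (hg : StronglyMeasurable g) :
    ∫ x, g x ∂ρ.map (fun s : ℝ => (s : AddCircle T)) = ∫ s, g s ∂ρ :=
  integral_map AddCircle.measurable_mk'.aemeasurable hg.aestronglyMeasurable

variable {ρ : Measure ℝ} [IsFiniteMeasure ρ]

lemma Function.Periodic.tendsto_integral_comp_natCast_mul
    (hρ : Tendsto (fun n : ℤ => ∫ x, fourier n x ∂ρ.map (fun s : ℝ => (s : AddCircle (1 : ℝ))))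
      cofinite (nhds 0)) {g : ℝ → ℝ} (hper : Function.Periodic g 1) (hg : Continuous g) :
    Tendsto (fun n : ℕ => ∫ s, g (n * s) ∂ρ) atTop
      (nhds (ρ.real Set.univ * ∫ s in (0 : ℝ)..1, g s)) := by
  have hlift : Continuous (hper.lift : AddCircle (1 : ℝ) → ℝ) := hg.quotient_lift _
  let G : C(AddCircle (1 : ℝ), ℂ) := ⟨fun x => (hper.lift x : ℂ), by fun_prop⟩
  have hG (s : ℝ) : G s = g s := rfl
  have h := tendsto_integral_continuousMap_nsmul hρ G
  have hmass : (ρ.map (fun s : ℝ => (s : AddCircle (1 : ℝ)))).real Set.univ = ρ.real Set.univ := by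
    rw [map_measureReal_apply AddCircle.measurable_mk' MeasurableSet.univ, Set.preimage_univ]
  have hhaar : ∫ x, G x ∂AddCircle.haarAddCircle = ((∫ s in (0 : ℝ)..1, g s : ℝ) : ℂ) := by
    rw [AddCircle.integral_haarAddCircle, ← AddCircle.intervalIntegral_preimage 1 0]
    simp [hG, intervalIntegral.integral_ofReal]
  have hleft (n : ℕ) : ∫ x, G (n • x) ∂ρ.map (fun s : ℝ => (s : AddCircle (1 : ℝ)))
      = ((∫ s, g (n * s) ∂ρ : ℝ) : ℂ) := by
    rw [integral_map_coe_addCircle (fun x => G (n • x))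
      (by fun_prop : Continuous fun x => G (n • x)).stronglyMeasurable, ← integral_complex_ofReal]
    simp_rw [← AddCircle.coe_nsmul, hG, nsmul_eq_mul]
  simp_rw [hleft, hmass, hhaar, ← Complex.ofReal_mul] at h
  exact (Complex.continuous_re.tendsto _).comp h

/-- The Lipschitz regularization `x ↦ sup_y (f y - k |x - y|)` of a function from above. -/
noncomputable def lipschitzMajorant (f : ℝ → ℝ) (k : ℕ) (x : ℝ) : ℝ := ⨆ y, (f y - k * |x - y|)

section lipschitzMajorant

variable {f : ℝ → ℝ} {C : ℝ}

lemma bddAbove_range_sub_mul_abs (hfb : ∀ x, |f x| ≤ C) (k : ℕ) (x : ℝ) :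
    BddAbove (Set.range fun y => f y - k * |x - y|) := by
  refine ⟨C, ?_⟩
  rintro _ ⟨y, rfl⟩
  have : 0 ≤ k * |x - y| := by positivity
  linarith [le_of_abs_le (hfb y)]

lemma le_lipschitzMajorant (hfb : ∀ x, |f x| ≤ C) (k : ℕ) (x : ℝ) :
    f x ≤ lipschitzMajorant f k x := by
  simpa [lipschitzMajorant] using le_ciSup (bddAbove_range_sub_mul_abs hfb k x) x

lemma abs_lipschitzMajorant_le (hfb : ∀ x, |f x| ≤ C) (k : ℕ) (x : ℝ) :
    |lipschitzMajorant f k x| ≤ C := by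
  refine abs_le.2 ⟨(neg_le_of_abs_le (hfb x)).trans (le_lipschitzMajorant hfb k x), ?_⟩
  refine ciSup_le fun y => ?_
  have : 0 ≤ k * |x - y| := by positivity
  linarith [le_of_abs_le (hfb y)]

lemma lipschitzWith_lipschitzMajorant (hfb : ∀ x, |f x| ≤ C) (k : ℕ) :
    LipschitzWith k (lipschitzMajorant f k) := by
  refine .of_le_add_mul _ fun x x' => ciSup_le fun y => ?_
  have h := le_ciSup (bddAbove_range_sub_mul_abs hfb k x') y
  have h' : (k : ℝ) * |x' - y| ≤ k * (|x - x'| + |x - y|) := by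
    gcongr
    rw [abs_sub_comm x x']
    exact abs_sub_le _ _ _
  rw [Real.dist_eq, NNReal.coe_natCast]
  change _ ≤ lipschitzMajorant f k x' at h
  linarith

lemma Function.Periodic.lipschitzMajorant {c : ℝ} (hper : Function.Periodic f c) (k : ℕ) :
    Function.Periodic (lipschitzMajorant f k) c := fun x => by
  refine ((Equiv.addRight c).iSup_congr fun y => ?_).symm
  simp [hper y]

lemma ContinuousAt.tendsto_lipschitzMajorant (hfb : ∀ x, |f x| ≤ C) {x : ℝ}
    (hx : ContinuousAt f x) :
    Tendsto (fun k => lipschitzMajorant f k x) atTop (nhds (f x)) := by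
  rw [Metric.tendsto_atTop]
  intro ε hε
  obtain ⟨δ, hδ, h⟩ := Metric.continuousAt_iff.1 hx (ε / 2) (half_pos hε)
  obtain ⟨N, hN⟩ := exists_nat_ge (2 * C / δ)
  refine ⟨N, fun k hk => ?_⟩
  rw [Real.dist_eq, abs_of_nonneg (sub_nonneg.2 (le_lipschitzMajorant hfb k x))]
  suffices _root_.lipschitzMajorant f k x ≤ f x + ε / 2 by linarith
  refine ciSup_le fun y => ?_
  rcases lt_or_ge |x - y| δ with hy | hy
  · have := h (x := y) (by rwa [Real.dist_eq, abs_sub_comm])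
    rw [Real.dist_eq] at this
    have h0 : 0 ≤ k * |x - y| := by positivity
    linarith [lt_of_abs_lt this]
  · have : 2 * C ≤ k * |x - y| := by
      rw [div_le_iff₀ hδ] at hN
      refine hN.trans ?_
      gcongr
    linarith [le_of_abs_le (hfb y), neg_le_of_abs_le (hfb x)]

lemma tendsto_intervalIntegral_lipschitzMajorant (hfb : ∀ x, |f x| ≤ C)
    (hRiemann : volume {x : ℝ | ¬ ContinuousAt f x} = 0) (a b : ℝ) :
    Tendsto (fun k => ∫ s in a..b, lipschitzMajorant f k s) atTop (nhds (∫ s in a..b, f s)) := by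
  refine intervalIntegral.tendsto_integral_filter_of_dominated_convergence (fun _ => C)
    (.of_forall fun k => ?_) (.of_forall fun k => .of_forall fun x _ => ?_) (by simp) ?_
  · exact (lipschitzWith_lipschitzMajorant hfb k).continuous.aestronglyMeasurable
  · exact abs_lipschitzMajorant_le hfb k x
  · filter_upwards [show ∀ᵐ x, ContinuousAt f x from hRiemann] with x hx _
    exact hx.tendsto_lipschitzMajorant hfb

end lipschitzMajorant

variable {f : ℝ → ℝ} {C : ℝ}

lemma eventually_integral_comp_natCast_mul_lt
    (hρ : Tendsto (fun n : ℤ => ∫ x, fourier n x ∂ρ.map (fun s : ℝ => (s : AddCircle (1 : ℝ))))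
      cofinite (nhds 0))
    (hfm : Measurable f) (hfb : ∀ x, |f x| ≤ C) (hper : Function.Periodic f 1)
    (hRiemann : volume {x : ℝ | ¬ ContinuousAt f x} = 0) {c : ℝ}
    (hc : ρ.real Set.univ * ∫ s in (0 : ℝ)..1, f s < c) :
    ∀ᶠ n : ℕ in atTop, ∫ s, f (n * s) ∂ρ < c := by
  obtain ⟨k, hk⟩ := (((tendsto_intervalIntegral_lipschitzMajorant hfb hRiemann 0 1).const_mul
    (ρ.real Set.univ)).eventually_lt_const hc).exists
  have hcont := (lipschitzWith_lipschitzMajorant hfb k).continuous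
  filter_upwards [((hper.lipschitzMajorant k).tendsto_integral_comp_natCast_mul hρ
    hcont).eventually_lt_const hk] with n hn
  refine (integral_mono ?_ ?_ fun s => le_lipschitzMajorant hfb k (n * s)).trans_lt hn
  · exact .of_bound (hfm.comp (measurable_const_mul _)).aestronglyMeasurable C
      (.of_forall fun s => hfb _)
  · exact .of_bound (by fun_prop) C (.of_forall fun s => abs_lipschitzMajorant_le hfb k _)

/-- Equidistribution of a Rajchman measure tested against Riemann-integrable functions. -/
lemma tendsto_integral_comp_natCast_mul_of_ae_continuousAt
    (hρ : Tendsto (fun n : ℤ => ∫ x, fourier n x ∂ρ.map (fun s : ℝ => (s : AddCircle (1 : ℝ))))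
      cofinite (nhds 0))
    (hfm : Measurable f) (hfb : ∀ x, |f x| ≤ C) (hper : Function.Periodic f 1)
    (hRiemann : volume {x : ℝ | ¬ ContinuousAt f x} = 0) :
    Tendsto (fun n : ℕ => ∫ s, f (n * s) ∂ρ) atTop
      (nhds (ρ.real Set.univ * ∫ s in (0 : ℝ)..1, f s)) := by
  refine tendsto_order.2 ⟨fun c hc => ?_, fun c hc =>
    eventually_integral_comp_natCast_mul_lt hρ hfm hfb hper hRiemann hc⟩
  have hneg : volume {x : ℝ | ¬ ContinuousAt (fun y => -f y) x} = 0 :=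
    measure_mono_null (fun x hx (h : ContinuousAt f x) => hx h.neg) hRiemann
  have h := eventually_integral_comp_natCast_mul_lt hρ hfm.neg (C := C) (by simpa using hfb)
    (fun x => by simp [hper x]) hneg (c := -c) (by simpa using hc)
  filter_upwards [h] with n hn
  simpa [integral_neg] using hn

/-- The difference of two partial integrals is controlled by the mass between the endpoints. -/
lemma abs_setIntegral_Icc_sub_le {g : ℝ → ℝ} (hg : Measurable g) (hgb : ∀ x, |g x| ≤ C)
    {c a b t t' : ℝ} (ht : t ∈ Set.Icc a b) (ht' : t' ∈ Set.Icc a b) :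
    |(∫ s in Set.Icc c t, g s ∂ρ) - ∫ s in Set.Icc c t', g s ∂ρ| ≤ C * ρ.real (Set.Icc a b) := by
  wlog h : t' ≤ t generalizing t t'
  · rw [abs_sub_comm]
    exact this ht' ht (le_of_not_ge h)
  have hC : 0 ≤ C := (abs_nonneg _).trans (hgb 0)
  have hint : Integrable g ρ := .of_bound hg.aestronglyMeasurable C (.of_forall hgb)
  rw [← setIntegral_sdiff measurableSet_Icc hint.integrableOn (Set.Icc_subset_Icc_right h)]
  refine (norm_setIntegral_le_of_norm_le_const (f := g) (measure_lt_top _ _)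
    fun x _ => hgb x).trans ?_
  gcongr
  · finiteness
  · rintro x ⟨⟨h₁, h₂⟩, h₃⟩
    have h₄ : t' < x := by
      by_contra! h'
      exact h₃ ⟨h₁, h'⟩
    exact ⟨ht'.1.trans h₄.le, h₂.trans ht.2⟩

end Line

/-- If `μ` is a finite Rajchman measure on `[0,1]` and `f` is a bounded
Riemann-integrable 1-periodic function with `∫₀¹ f = 0`, then
`sup_{0≤t≤1} |∫₀ᵗ f(ns) dμ(s)| → 0` as `n → ∞`. -/
theorem stmt10 (μ : Measure ℝ) [IsFiniteMeasure μ]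
    (hsupp : μ (Set.Icc (0:ℝ) 1)ᶜ = 0)
    (hRaj : Tendsto (fun n : ℤ => ∫ s, Complex.exp (2 * Real.pi * Complex.I * (n * s)) ∂μ)
      (cocompact ℤ) (nhds 0))
    (f : ℝ → ℝ) (hfm : Measurable f) (C : ℝ) (hfb : ∀ x, |f x| ≤ C)
    (hper : Function.Periodic f 1)
    (hRiemann : volume {x : ℝ | ¬ ContinuousAt f x} = 0)
    (hzero : ∫ s in (0:ℝ)..1, f s = 0) :
    Tendsto (fun n : ℕ =>
        ⨆ t ∈ Set.Icc (0:ℝ) 1, |∫ s in Set.Icc (0:ℝ) t, f ((n:ℝ) * s) ∂μ|)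
      atTop (nhds 0) := by
  have hμ : Tendsto (fun n : ℤ => ∫ x, fourier n x ∂μ.map (fun s : ℝ => (s : AddCircle (1 : ℝ))))
      cofinite (nhds 0) := by
    rw [cocompact_eq_cofinite] at hRaj
    refine hRaj.congr fun n => ?_
    rw [integral_map_coe_addCircle _ (fourier n).continuous.stronglyMeasurable]
    simp [mul_assoc]
  have : NullSingletonClass μ := ⟨fun s => by
    refine measure_mono_null ?_ ((Measure.map_apply AddCircle.measurable_mk'
      (measurableSet_singleton _)).symm.trans
      (measure_singleton_eq_zero_of_tendsto_integral_fourier hμ (s : AddCircle (1 : ℝ))))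
    rintro _ rfl
    rfl⟩
  have hpt (t : ℝ) : Tendsto (fun n : ℕ => ∫ s in Set.Icc 0 t, f (n * s) ∂μ) atTop (nhds 0) := by
    have hac : (μ.restrict (Set.Icc 0 t)).map (fun s : ℝ => (s : AddCircle (1 : ℝ))) ≪
        μ.map (fun s : ℝ => (s : AddCircle (1 : ℝ))) :=
      Measure.restrict_le_self.absolutelyContinuous.map AddCircle.measurable_mk'
    simpa [hzero] using tendsto_integral_comp_natCast_mul_of_ae_continuousAt
      (tendsto_integral_fourier_of_absolutelyContinuous hac hμ) hfm hfb hper hRiemann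
  have hunif : TendstoUniformlyOn (fun (n : ℕ) t => ∫ s in Set.Icc 0 t, f (n * s) ∂μ) 0 atTop
      (Set.Icc 0 1) := by
    rw [← tendstoLocallyUniformlyOn_iff_tendstoUniformlyOn_of_compact isCompact_Icc,
      Metric.tendstoLocallyUniformlyOn_iff]
    intro ε hε t _
    have hmass : Tendsto (fun δ => C * μ.real (Set.Icc (t - δ) (t + δ))) (nhds 0) (nhds 0) := by
      simpa [Measure.real] using ((ENNReal.tendsto_toReal ENNReal.zero_ne_top).comp
        (tendsto_measure_Icc μ t)).const_mul C
    obtain ⟨δ, hδ, hδ0⟩ := (((hmass.mono_left nhdsWithin_le_nhds).eventually_lt_const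
      (half_pos hε)).and (self_mem_nhdsWithin (s := Set.Ioi (0 : ℝ)))).exists
    have hδ0 : 0 < δ := hδ0
    refine ⟨Set.Icc (t - δ) (t + δ), mem_nhdsWithin_of_mem_nhds
      (Icc_mem_nhds (by linarith) (by linarith)), ?_⟩
    filter_upwards [NormedAddGroup.tendsto_nhds_zero.1 (hpt t) (ε / 2) (half_pos hε)]
      with n hn t' ht'
    have h := abs_setIntegral_Icc_sub_le (ρ := μ) (g := fun s => f (n * s)) (c := 0)
      (by fun_prop) (fun x => hfb _) ht' (t' := t) ⟨by linarith, by linarith⟩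
    rw [Pi.zero_apply, dist_zero_left, Real.norm_eq_abs]
    rw [Real.norm_eq_abs] at hn
    have h₂ := abs_sub_abs_le_abs_sub (∫ s in Set.Icc 0 t', f (n * s) ∂μ)
      (∫ s in Set.Icc 0 t, f (n * s) ∂μ)
    linarith
  rw [NormedAddGroup.tendsto_nhds_zero]
  intro ε hε
  filter_upwards [Metric.tendstoUniformlyOn_iff.1 hunif (ε / 2) (half_pos hε)] with n hn
  rw [Real.norm_of_nonneg (Real.iSup_nonneg fun t => Real.iSup_nonneg fun _ => abs_nonneg _)]
  refine lt_of_le_of_lt (Real.iSup_le (fun t => Real.iSup_le (fun ht => ?_) (half_pos hε).le)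
    (half_pos hε).le) (half_lt_self hε)
  simpa using (hn t ht).le
end
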